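/- arXiv:1403.3954 — 4 statements merged into one kernel-verified Lean document; each statement's English description precedes it below -/
import Mathlib

section
/- If Z is a nonempty compact metrizable topological space whose small inductive dimension equals k (for a natural number k), then the unreduced suspension ΣZ of Z is a compact metrizable space whose small inductive dimension equals k + 1. -/
open Set Filter Topology

universe u

/-- The equivalence generating the unreduced suspension: collapse `W × {0}` to a point `n`
and `W × {1}` to a point `p`. -/
def suspRel (W : Type u) : W × unitInterval → W × unitInterval → Prop := fun a b =>
  a = b ∨ (a.2 = 0 ∧ b.2 = 0) ∨ (a.2 = 1 ∧ b.2 = 1)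

/-- The unreduced suspension `ΣW` of `W`, as a quotient of `W × [0,1]`. -/
def Susp (W : Type u) : Type u := Quot (suspRel W)

instance (W : Type u) [TopologicalSpace W] : TopologicalSpace (Susp W) :=
  inferInstanceAs (TopologicalSpace (Quot (suspRel W)))

/-- The image of `(w, t)` in the suspension. -/
def suspMk (W : Type u) [TopologicalSpace W] (w : W) (t : unitInterval) : Susp W :=
  Quot.mk _ (w, t)

/-- The set `{n, p}` of the two suspension points of `ΣW` (for `W` nonempty),
i.e. the image of `W × {0, 1}`. -/
def suspPoles (W : Type u) [TopologicalSpace W] : Set (Susp W) :=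
  {z | ∃ w t, z = suspMk W w t ∧ (t = 0 ∨ t = 1)}

/-- The suspension arc of `ΣW` through `w ∈ W`: the image of `{w} × [0,1]`. -/
def suspArc (W : Type u) [TopologicalSpace W] (w : W) : Set (Susp W) :=
  {z | ∃ t, z = suspMk W w t}

/-- `IndLEnat k X` means the small inductive dimension of `X` is at most `k - 1`:
`IndLEnat 0 X` iff `X = ∅`, and `IndLEnat (k+1) X` iff every point of `X` has arbitrarily
small open neighborhoods whose topological boundary `B` satisfies `IndLEnat k B`. -/
def IndLEnat : ℕ → (X : Type u) → [inst : TopologicalSpace X] → Prop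
  | 0, X, _ => IsEmpty X
  | (k+1), X, _ => ∀ (x : X) (U : Set X), IsOpen U → x ∈ U →
      ∃ V : Set X, IsOpen V ∧ x ∈ V ∧ V ⊆ U ∧ IndLEnat k ↥(frontier V)

/-- `IndLE X n`: the small inductive dimension of `X` is at most `n ∈ {-1, 0, 1, 2, …}`. -/
def IndLE (X : Type u) [TopologicalSpace X] (n : ℤ) : Prop :=
  -1 ≤ n ∧ IndLEnat (n + 1).toNat X

/-- `IndEq X n`: the small inductive dimension of `X` equals `n`. -/
def IndEq (X : Type u) [TopologicalSpace X] (n : ℤ) : Prop :=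
  IndLE X n ∧ ¬ IndLE X (n - 1)

/-- Continuous maps `X → E` without zeros are uniformly dense among all continuous maps. For compact
metrizable `X` this says that the dimension of `X` is less than that of `E`. -/
def NonvanishingDense (X : Type*) [TopologicalSpace X] (E : Type*) [NormedAddCommGroup E] : Prop :=
  ∀ (f : C(X, E)) (ε : ℝ), 0 < ε → ∃ h : C(X, E), (∀ x, h x ≠ 0) ∧ ∀ x, ‖h x - f x‖ < ε

lemma isOpen_setOf_forall_mem_ne_zero {X E : Type*} [TopologicalSpace X] [CompactSpace X]
    [NormedAddCommGroup E] {K : Set X} (hK : IsClosed K) :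
    IsOpen {h : C(X, E) | ∀ x ∈ K, h x ≠ 0} :=
  ContinuousMap.isOpen_setOfPred_mapsTo hK.isCompact isOpen_compl_singleton

/-- Tietze extension of a perturbation: a small perturbation of `f` on a closed subset extends to a
small perturbation of `f`. -/
lemma exists_extension_norm_sub_lt {Y X E : Type*} [TopologicalSpace Y] [CompactSpace Y]
    [TopologicalSpace X] [NormalSpace X] [NormedAddCommGroup E] [NormedSpace ℝ E]
    [FiniteDimensional ℝ E] {e : Y → X} (he : IsClosedEmbedding e) (f : C(X, E)) (g : C(Y, E))
    {ε : ℝ} (hε : 0 < ε) (hg : ∀ y, ‖g y - f (e y)‖ < ε) :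
    ∃ h : C(X, E), (∀ y, h (e y) = g y) ∧ ∀ x, ‖h x - f x‖ < ε := by
  let d : C(Y, E) := g - f.comp ⟨e, he.continuous⟩
  obtain ⟨r, hr, hrε, hd⟩ : ∃ r, 0 < r ∧ r < ε ∧ ∀ y, d y ∈ Metric.closedBall (0 : E) r := by
    refine ⟨max ‖d‖ (ε / 2), by positivity, max_lt ?_ (by linarith), fun y => ?_⟩
    · exact (ContinuousMap.norm_lt_iff _ hε).2 hg
    · simpa using Or.inl (d.norm_coe_le_norm y)
  have := Metric.instTietzeExtensionClosedBall ℝ (0 : E) hr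
  obtain ⟨D, hD, hDd⟩ := ContinuousMap.exists_extension_forall_mem he d hd
  refine ⟨f + D, fun y => ?_, fun x => ?_⟩
  · have : D (e y) = d y := congr($hDd y)
    simp [this, d]
  · simpa using (mem_closedBall_zero_iff.1 (hD x)).trans_lt hrε

namespace NonvanishingDense

lemma of_isClosedEmbedding {Y X E : Type*} [TopologicalSpace Y] [TopologicalSpace X]
    [NormalSpace X] [NormedAddCommGroup E] [NormedSpace ℝ E]
    [FiniteDimensional ℝ E] {e : Y → X} (he : IsClosedEmbedding e) (h : NonvanishingDense X E) :
    NonvanishingDense Y E := by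
  intro f ε hε
  obtain ⟨F, hF⟩ := f.exists_extension he
  obtain ⟨H, hH0, hH⟩ := h F ε hε
  refine ⟨H.comp ⟨e, he.continuous⟩, fun y => hH0 _, fun y => ?_⟩
  have : F (e y) = f y := congr($hF y)
  simpa [this] using hH (e y)

lemma mono_set {X E : Type*} [TopologicalSpace X] [NormalSpace X]
    [NormedAddCommGroup E] [NormedSpace ℝ E] [FiniteDimensional ℝ E] {K L : Set X}
    (hK : IsClosed K) (hL : IsClosed L) (hKL : K ⊆ L) (h : NonvanishingDense L E) :
    NonvanishingDense K E :=
  have : NormalSpace L := hL.isClosedEmbedding_subtypeVal.normalSpace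
  h.of_isClosedEmbedding (e := inclusion hKL)
    ⟨.inclusion hKL, by rw [range_inclusion]; exact hK.preimage continuous_subtype_val⟩

lemma congr_finrank {X E F : Type*} [TopologicalSpace X]
    [NormedAddCommGroup E] [NormedSpace ℝ E] [FiniteDimensional ℝ E]
    [NormedAddCommGroup F] [NormedSpace ℝ F] [FiniteDimensional ℝ F]
    (hEF : Module.finrank ℝ E = Module.finrank ℝ F) (h : NonvanishingDense X E) :
    NonvanishingDense X F := by
  intro f ε hε
  let e : E ≃L[ℝ] F := .ofFinrankEq hEF
  obtain ⟨C, hC, hle⟩ := e.toContinuousLinearMap.bound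
  obtain ⟨H, hH0, hH⟩ := h ((e.symm : C(F, E)).comp f) (ε / C) (by positivity)
  refine ⟨(e : C(E, F)).comp H, fun x => ?_, fun x => ?_⟩
  · simpa using hH0 x
  · calc ‖e (H x) - f x‖ = ‖e (H x - e.symm (f x))‖ := by simp
      _ ≤ C * ‖H x - e.symm (f x)‖ := hle _
      _ < C * (ε / C) := by gcongr; exact hH x
      _ = ε := by field_simp

lemma prod_right {X E : Type*} (F : Type*) [TopologicalSpace X] [NormedAddCommGroup E]
    [NormedAddCommGroup F] (h : NonvanishingDense X E) : NonvanishingDense X (E × F) := by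
  intro f ε hε
  obtain ⟨H, hH0, hH⟩ := h ((ContinuousMap.fst).comp f) ε hε
  refine ⟨H.prodMk ((ContinuousMap.snd).comp f), fun x hx => hH0 x (congr_arg Prod.fst hx),
    fun x => ?_⟩
  simpa [Prod.norm_def, hε] using hH x

lemma of_isEmpty (X E : Type*) [TopologicalSpace X] [NormedAddCommGroup E] [IsEmpty X] :
    NonvanishingDense X E :=
  fun f _ _ => ⟨f, isEmptyElim, isEmptyElim⟩

/-- Countable closed sum theorem. -/
lemma exists_forall_mem_ne_zero {X E : Type*} [TopologicalSpace X] [CompactSpace X] [T2Space X]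
    [NormedAddCommGroup E] [NormedSpace ℝ E] [FiniteDimensional ℝ E] {𝒮 : Set (Set X)}
    (hc : 𝒮.Countable) (hcl : ∀ S ∈ 𝒮, IsClosed S) (hS : ∀ S ∈ 𝒮, NonvanishingDense S E)
    (f : C(X, E)) {ε : ℝ} (hε : 0 < ε) :
    ∃ h : C(X, E), (∀ S ∈ 𝒮, ∀ x ∈ S, h x ≠ 0) ∧ ∀ x, ‖h x - f x‖ < ε := by
  have : CompleteSpace E := FiniteDimensional.complete ℝ E
  have hd : Dense (⋂ S ∈ 𝒮, {h : C(X, E) | ∀ x ∈ S, h x ≠ 0}) := by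
    refine dense_biInter_of_isOpen (fun S h => isOpen_setOf_forall_mem_ne_zero (hcl S h)) hc
      fun S h => Metric.dense_iff.2 fun g r hr => ?_
    have : CompactSpace S := isCompact_iff_compactSpace.1 (hcl S h).isCompact
    obtain ⟨k, hk0, hk⟩ := hS S h (g.restrict S) r hr
    obtain ⟨K, hK, hKg⟩ := exists_extension_norm_sub_lt (hcl S h).isClosedEmbedding_subtypeVal
      g k hr hk
    refine ⟨K, ?_, fun x hx => ?_⟩
    · rw [Metric.mem_ball, ContinuousMap.dist_lt_iff hr]
      simpa [dist_eq_norm] using hKg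
    · rw [hK ⟨x, hx⟩]
      exact hk0 _
  obtain ⟨h, hh, h0⟩ := Metric.dense_iff.1 hd f ε hε
  rw [Metric.mem_ball, ContinuousMap.dist_lt_iff hε] at hh
  exact ⟨h, by simpa using h0, by simpa [dist_eq_norm] using hh⟩

lemma of_sUnion {X E : Type*} [TopologicalSpace X] [CompactSpace X] [T2Space X]
    [NormedAddCommGroup E] [NormedSpace ℝ E] [FiniteDimensional ℝ E] {𝒮 : Set (Set X)}
    (hc : 𝒮.Countable) (hcl : ∀ S ∈ 𝒮, IsClosed S) (hS : ∀ S ∈ 𝒮, NonvanishingDense S E)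
    (hX : ⋃₀ 𝒮 = univ) : NonvanishingDense X E := by
  intro f ε hε
  obtain ⟨h, h0, hh⟩ := exists_forall_mem_ne_zero hc hcl hS f hε
  refine ⟨h, fun x => ?_, hh⟩
  obtain ⟨S, hSS, hx⟩ := mem_sUnion.1 (hX ▸ mem_univ x)
  exact h0 S hSS x hx

/-- If countably many closed sets are small with respect to `F` and every closed set avoiding
them is small with respect to `E`, then the space is small with respect to `F × E`. -/
lemma prod_of_forall_disjoint {X E F : Type*} [TopologicalSpace X] [CompactSpace X] [T2Space X]
    [NormedAddCommGroup E] [NormedSpace ℝ E] [FiniteDimensional ℝ E]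
    [NormedAddCommGroup F] [NormedSpace ℝ F] [FiniteDimensional ℝ F] {𝒮 : Set (Set X)}
    (hc : 𝒮.Countable) (hcl : ∀ S ∈ 𝒮, IsClosed S) (hS : ∀ S ∈ 𝒮, NonvanishingDense S F)
    (hK : ∀ K : Set X, IsClosed K → (∀ S ∈ 𝒮, Disjoint K S) → NonvanishingDense K E) :
    NonvanishingDense X (F × E) := by
  intro f ε hε
  obtain ⟨u, hu0, hu⟩ := exists_forall_mem_ne_zero hc hcl hS ((ContinuousMap.fst).comp f) hε
  let K : Set X := {x | u x = 0}
  have hKc : IsClosed K := isClosed_eq u.continuous continuous_const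
  have hKd : NonvanishingDense K E := hK K hKc fun S hS =>
    Set.disjoint_left.2 fun x hx hxS => hu0 S hS x hxS hx
  obtain ⟨v, hv0, hv⟩ := exists_forall_mem_ne_zero (countable_singleton K) (by simpa using hKc)
    (by simpa using hKd) ((ContinuousMap.snd).comp f) hε
  refine ⟨u.prodMk v, fun x hx => ?_, fun x => ?_⟩
  · have := Prod.mk_eq_zero.1 hx
    exact hv0 K rfl x this.1 this.2
  · simpa [Prod.norm_def] using ⟨hu x, hv x⟩

lemma real_of_totallyDisconnectedSpace (X : Type*) [TopologicalSpace X] [CompactSpace X]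
    [T2Space X] [TotallyDisconnectedSpace X] : NonvanishingDense X ℝ := by
  intro f ε hε
  obtain ⟨C, hC, hZC, hCU⟩ := exists_clopen_of_closed_subset_open (Z := {x | 0 ≤ f x})
    (U := {x | -(ε / 2) < f x}) (isClosed_le continuous_const f.continuous)
    (isOpen_lt continuous_const f.continuous) (fun x (hx : 0 ≤ f x) => by
      show -(ε / 2) < f x
      linarith)
  classical
  refine ⟨⟨fun x => f x + if x ∈ C then ε / 2 else -(ε / 2), f.continuous.add ?_⟩, fun x => ?_,
    fun x => ?_⟩
  · exact continuous_const.if (fun a ha => by simp [hC.frontier_eq] at ha) continuous_const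
  · by_cases hx : x ∈ C
    · have : -(ε / 2) < f x := hCU hx
      simp only [ContinuousMap.coe_mk, hx, if_true]
      exact ne_of_gt (by linarith)
    · have : f x < 0 := not_le.1 fun h => hx (hZC h)
      simp only [ContinuousMap.coe_mk, hx, if_false]
      exact ne_of_lt (by linarith)
  · by_cases hx : x ∈ C <;> simp [hx, abs_of_pos hε, hε]

end NonvanishingDense

/-- In a second countable space with a basis of open sets satisfying `P`, countably many such sets
separate the points. -/
lemma exists_countable_separating_isOpen {X : Type*} [TopologicalSpace X] [SecondCountableTopology X]
    [T1Space X] {P : Set X → Prop}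
    (h : ∀ (x : X) (U : Set X), IsOpen U → x ∈ U → ∃ V, IsOpen V ∧ x ∈ V ∧ V ⊆ U ∧ P V) :
    ∃ 𝒱 : Set (Set X), 𝒱.Countable ∧ (∀ V ∈ 𝒱, IsOpen V ∧ P V) ∧
      ∀ x y, x ≠ y → ∃ V ∈ 𝒱, x ∈ V ∧ y ∉ V := by
  let ℬ := TopologicalSpace.countableBasis X
  let Q : Set X × Set X → Set X → Prop := fun p V => IsOpen V ∧ P V ∧ p.1 ⊆ V ∧ V ⊆ p.2
  have hB := TopologicalSpace.isBasis_countableBasis X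
  have hcB : ℬ.Countable := TopologicalSpace.countable_countableBasis X
  refine ⟨(fun p => Classical.epsilon (Q p)) '' {p ∈ ℬ ×ˢ ℬ | ∃ V, Q p V},
    ((hcB.prod hcB).mono (sep_subset _ _)).image _, ?_, fun x y hxy => ?_⟩
  · rintro _ ⟨p, ⟨-, hp⟩, rfl⟩
    exact ⟨(Classical.epsilon_spec hp).1, (Classical.epsilon_spec hp).2.1⟩
  · obtain ⟨B', hB', hxB', hB'y⟩ := hB.exists_subset_of_mem_open
      (show x ∈ ({y} : Set X)ᶜ from hxy) isOpen_compl_singleton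
    obtain ⟨V, hVo, hxV, hVB', hPV⟩ := h x B' (hB.isOpen hB') hxB'
    obtain ⟨B, hB₁, hxB, hBV⟩ := hB.exists_subset_of_mem_open hxV hVo
    have hp : ∃ V, Q (B, B') V := ⟨V, hVo, hPV, hBV, hVB'⟩
    refine ⟨_, ⟨(B, B'), ⟨⟨hB₁, hB'⟩, hp⟩, rfl⟩, ?_, fun hy => ?_⟩
    · exact (Classical.epsilon_spec hp).2.2.1 hxB
    · exact hB'y ((Classical.epsilon_spec hp).2.2.2 hy) rfl

namespace NonvanishingDense

lemma range {Y X E : Type*} [TopologicalSpace Y] [NormalSpace Y] [TopologicalSpace X]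
    [NormedAddCommGroup E] [NormedSpace ℝ E] [FiniteDimensional ℝ E] {e : Y → X}
    (he : IsEmbedding e) (h : NonvanishingDense Y E) : NonvanishingDense (range e) E :=
  h.of_isClosedEmbedding he.toHomeomorph.symm.isClosedEmbedding

lemma image {Y X E : Type*} [TopologicalSpace Y] [TopologicalSpace X]
    [NormedAddCommGroup E] [NormedSpace ℝ E] [FiniteDimensional ℝ E] {e : Y → X}
    (he : IsEmbedding e) {S : Set Y} [NormalSpace S] (h : NonvanishingDense S E) :
    NonvanishingDense (e '' S) E := by
  have := h.range (he.comp .subtypeVal)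
  rwa [range_comp, Subtype.range_val] at this

lemma preimage {Y X E : Type*} [TopologicalSpace Y] [TopologicalSpace X]
    [NormedAddCommGroup E] [NormedSpace ℝ E] [FiniteDimensional ℝ E] {e : Y → X}
    (he : IsClosedEmbedding e) {T : Set X} [NormalSpace T] (h : NonvanishingDense T E) :
    NonvanishingDense (e ⁻¹' T) E :=
  h.of_isClosedEmbedding (he.restrictPreimage T)

lemma real_of_separating {X : Type*} [TopologicalSpace X] [CompactSpace X] [T2Space X]
    {𝒱 : Set (Set X)} (ho : ∀ V ∈ 𝒱, IsOpen V) (hsep : ∀ x y, x ≠ y → ∃ V ∈ 𝒱, x ∈ V ∧ y ∉ V)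
    {K : Set X} (hK : IsClosed K) (hd : ∀ V ∈ 𝒱, Disjoint K (frontier V)) :
    NonvanishingDense K ℝ := by
  have : CompactSpace K := isCompact_iff_compactSpace.1 hK.isCompact
  have : TotallySeparatedSpace K := totallySeparatedSpace_iff_exists_isClopen.2 fun x y hxy => by
    obtain ⟨V, hV, hx, hy⟩ := hsep x y (Subtype.coe_ne_coe.2 hxy)
    refine ⟨Subtype.val ⁻¹' V, ⟨?_, (ho V hV).preimage continuous_subtype_val⟩, hx, hy⟩
    have : (Subtype.val ⁻¹' V : Set K) = Subtype.val ⁻¹' closure V := by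
      ext z
      refine ⟨fun hz => subset_closure hz, fun hz => ?_⟩
      by_contra hzV
      exact Set.disjoint_left.1 (hd V hV) z.2 ((ho V hV).frontier_eq ▸ ⟨hz, hzV⟩)
    rw [this]
    exact isClosed_closure.preimage continuous_subtype_val
  exact real_of_totallyDisconnectedSpace K

/-- If a compact metrizable space is small with respect to `ℝ × E`, then each of its points has
arbitrarily small neighbourhoods whose frontiers are small with respect to `E`. -/
lemma exists_isOpen_frontier {X E : Type*} [TopologicalSpace X] [CompactSpace X]
    [TopologicalSpace.MetrizableSpace X] [NormedAddCommGroup E] [NormedSpace ℝ E]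
    [FiniteDimensional ℝ E] (h : NonvanishingDense X (ℝ × E)) {x : X} {U : Set X} (hU : IsOpen U)
    (hx : x ∈ U) : ∃ V, IsOpen V ∧ x ∈ V ∧ V ⊆ U ∧ NonvanishingDense (frontier V) E := by
  let _ := TopologicalSpace.metrizableSpaceMetric X
  have : CompleteSpace E := FiniteDimensional.complete ℝ E
  have : ProperSpace E := FiniteDimensional.proper ℝ E
  let O : C(X, E) × ℕ → Set C(X, ℝ) := fun p =>
    {g | ∃ k : C(X, E), (∀ x, ‖k x - p.1 x‖ < 1 / ((p.2 : ℝ) + 1)) ∧ ∀ x, g x = 0 → k x ≠ 0}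
  obtain ⟨D, hDc, hDd⟩ := TopologicalSpace.exists_countable_dense C(X, E)
  have hdense : Dense (⋂ p ∈ D ×ˢ (univ : Set ℕ), O p) := by
    refine dense_biInter_of_isOpen (fun p _ => ?_) (hDc.prod countable_univ)
      fun p _ => Metric.dense_iff.2 fun g r hr => ?_
    · have : O p = ⋃ k ∈ {k : C(X, E) | ∀ x, ‖k x - p.1 x‖ < 1 / ((p.2 : ℝ) + 1)},
          (fun g : C(X, ℝ) => g.prodMk k) ⁻¹' {f : C(X, ℝ × E) | ∀ x ∈ univ, f x ≠ 0} := by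
        ext g
        simp [O]
      rw [this]
      refine isOpen_biUnion fun k _ => (isOpen_setOf_forall_mem_ne_zero isClosed_univ).preimage ?_
      exact ContinuousMap.continuous_of_continuous_uncurry _ (by
        show Continuous fun q : C(X, ℝ) × X => (q.1 q.2, k q.2)
        fun_prop)
    · obtain ⟨H, hH0, hH⟩ := h (g.prodMk p.1) (min r (1 / ((p.2 : ℝ) + 1))) (by positivity)
      have hH' : ∀ x, ‖(H x).1 - g x‖ < r ∧ ‖(H x).2 - p.1 x‖ < 1 / ((p.2 : ℝ) + 1) := fun x => by
        have := hH x
        simp only [Prod.norm_def, sup_lt_iff, lt_inf_iff] at this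
        exact ⟨this.1.1, this.2.2⟩
      refine ⟨ContinuousMap.fst.comp H, ?_, ContinuousMap.snd.comp H, fun x => (hH' x).2,
        fun x h1 h2 => hH0 x (Prod.ext h1 h2)⟩
      rw [Metric.mem_ball, ContinuousMap.dist_lt_iff hr]
      exact fun x => (dist_eq_norm _ _).trans_lt (hH' x).1
  obtain ⟨g₀, hg₀x, hg₀U, -⟩ := exists_continuous_zero_one_of_isClosed
    (isClosed_singleton (x := x)) hU.isClosed_compl (by simpa using hx)
  obtain ⟨g, hg, hgO⟩ := Metric.dense_iff.1 hdense (g₀ + g₀ - 1) 1 one_pos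
  rw [Metric.mem_ball, ContinuousMap.dist_lt_iff one_pos] at hg
  simp only [Real.dist_eq, abs_lt] at hg
  have hZ : IsClosed {x | g x = 0} := isClosed_eq g.continuous continuous_const
  have hfr : frontier {x | g x < 0} ⊆ {x | g x = 0} :=
    frontier_lt_subset_eq g.continuous continuous_const
  refine ⟨{x | g x < 0}, isOpen_lt g.continuous continuous_const, ?_, fun y hy => ?_, ?_⟩
  · have := (hg x).2
    have h0 : g₀ x = 0 := hg₀x rfl
    simp [h0] at this
    exact this
  · by_contra hyU
    have := (hg y).1
    have h1 : g₀ y = 1 := hg₀U hyU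
    have hy' : g y < 0 := hy
    simp [h1] at this
    linarith
  · refine mono_set isClosed_frontier hZ hfr fun f ε hε => ?_
    obtain ⟨F, hF⟩ := f.exists_extension hZ.isClosedEmbedding_subtypeVal
    obtain ⟨n, hn⟩ := exists_nat_one_div_lt (half_pos hε)
    obtain ⟨d, hd, hdD⟩ := Metric.dense_iff.1 hDd F (ε / 2) (half_pos hε)
    rw [Metric.mem_ball, ContinuousMap.dist_lt_iff (half_pos hε)] at hd
    obtain ⟨k, hk, hk0⟩ := mem_iInter₂.1 hgO (d, n) ⟨hdD, mem_univ _⟩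
    refine ⟨k.restrict _, fun z => hk0 z z.2, fun z => ?_⟩
    have hFz : F z = f z := congr($hF z)
    calc ‖k z - f z‖ = ‖(k z - d z) + (d z - F z)‖ := by rw [hFz]; abel_nf
      _ ≤ ‖k z - d z‖ + ‖d z - F z‖ := norm_add_le _ _
      _ < ε / 2 + ε / 2 := add_lt_add ((hk z).trans hn) (by simpa [dist_eq_norm] using hd z)
      _ = ε := add_halves ε

lemma exists_countable_separating_frontier {X E : Type*} [TopologicalSpace X] [CompactSpace X]
    [TopologicalSpace.MetrizableSpace X] [NormedAddCommGroup E] [NormedSpace ℝ E]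
    [FiniteDimensional ℝ E] (h : NonvanishingDense X (ℝ × E)) :
    ∃ 𝒱 : Set (Set X), 𝒱.Countable ∧ (∀ V ∈ 𝒱, IsOpen V ∧ NonvanishingDense (frontier V) E) ∧
      ∀ x y, x ≠ y → ∃ V ∈ 𝒱, x ∈ V ∧ y ∉ V := by
  let _ := TopologicalSpace.metrizableSpaceMetric X
  exact exists_countable_separating_isOpen fun x U hU hx => h.exists_isOpen_frontier hU hx

lemma isEmpty {X : Type*} [TopologicalSpace X] (h : NonvanishingDense X (Fin 0 → ℝ)) :
    IsEmpty X := by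
  obtain ⟨f, hf, -⟩ := h 0 1 one_pos
  exact ⟨fun x => hf x (Subsingleton.elim _ _)⟩

end NonvanishingDense

lemma indLEnat_iff_nonvanishingDense {n : ℕ} {X : Type u} [TopologicalSpace X] [CompactSpace X]
    [TopologicalSpace.MetrizableSpace X] : IndLEnat n X ↔ NonvanishingDense X (Fin n → ℝ) := by
  induction n generalizing X with
  | zero => exact ⟨fun (_ : IsEmpty X) => .of_isEmpty _ _, fun h => h.isEmpty⟩
  | succ n ih =>
    have hc (V : Set X) : CompactSpace (frontier V) :=
      isCompact_iff_compactSpace.1 isClosed_frontier.isCompact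
    constructor
    · intro h
      let _ := TopologicalSpace.metrizableSpaceMetric X
      obtain ⟨𝒱, h𝒱, hV, hsep⟩ := exists_countable_separating_isOpen
        (P := fun V => NonvanishingDense (frontier V) (Fin n → ℝ)) fun x U hU hx => by
          obtain ⟨V, hV, hxV, hVU, hi⟩ := h x U hU hx
          exact ⟨V, hV, hxV, hVU, ih.1 hi⟩
      refine (NonvanishingDense.prod_of_forall_disjoint (E := ℝ) (F := Fin n → ℝ)
        (𝒮 := frontier '' 𝒱) (h𝒱.image _) ?_ ?_ ?_).congr_finrank (by simp)
      · rintro _ ⟨V, -, rfl⟩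
        exact isClosed_frontier
      · rintro _ ⟨V, hV', rfl⟩
        exact (hV V hV').2
      · intro K hK hd
        exact .real_of_separating (fun V h => (hV V h).1) hsep hK
          fun V h => hd _ (mem_image_of_mem _ h)
    · intro h x U hU hx
      obtain ⟨V, hV, hxV, hVU, hN⟩ := (h.congr_finrank (F := ℝ × (Fin n → ℝ))
        (by simp [add_comm])).exists_isOpen_frontier hU hx
      exact ⟨V, hV, hxV, hVU, ih.2 hN⟩

namespace NonvanishingDense

/-- Decomposition theorem: outside countably many closed sets that are small with respect to `E`,
a compact space that is small with respect to `E × ℝᵐ` is small with respect to `ℝᵐ`. -/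
lemma exists_decomposition {E : Type*} [NormedAddCommGroup E] [NormedSpace ℝ E]
    [FiniteDimensional ℝ E] (m : ℕ) {X : Type u} [TopologicalSpace X] [CompactSpace X]
    [TopologicalSpace.MetrizableSpace X] (h : NonvanishingDense X (E × (Fin m → ℝ))) :
    ∃ 𝒮 : Set (Set X), 𝒮.Countable ∧ (∀ S ∈ 𝒮, IsClosed S ∧ NonvanishingDense S E) ∧
      ∀ K : Set X, IsClosed K → (∀ S ∈ 𝒮, Disjoint K S) → NonvanishingDense K (Fin m → ℝ) := by
  induction m generalizing X with
  | zero =>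
    refine ⟨{univ}, countable_singleton _, ?_, fun K _ hK => ?_⟩
    · rintro _ rfl
      refine ⟨isClosed_univ, ?_⟩
      have := (h.congr_finrank (F := E) (by simp)).range IsEmbedding.id
      rwa [range_id] at this
    · have : K = ∅ := by simpa using hK
      subst this
      exact .of_isEmpty _ _
  | succ m ih =>
    obtain ⟨𝒱, h𝒱, hV, hsep⟩ := (h.congr_finrank (F := ℝ × E × (Fin m → ℝ)) (by
      simp; ring)).exists_countable_separating_frontier
    have hcomp {L : Set X} (hL : IsClosed L) : CompactSpace L :=
      isCompact_iff_compactSpace.1 hL.isCompact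
    have := fun V => hcomp (isClosed_frontier (s := V))
    choose! 𝒯 h𝒯c h𝒯 hK𝒯 using fun V hV' => ih (X := frontier V) (hV V hV').2
    have hval {L : Set X} (hL : IsClosed L) : IsClosedEmbedding (Subtype.val : L → X) :=
      hL.isClosedEmbedding_subtypeVal
    refine ⟨⋃ V ∈ 𝒱, (Subtype.val '' ·) '' 𝒯 V, h𝒱.biUnion fun V h => (h𝒯c V h).image _, ?_, ?_⟩
    · intro S hS
      simp only [mem_iUnion, mem_image] at hS
      obtain ⟨V, hV', T, hT, rfl⟩ := hS
      have hTc := (h𝒯 V hV' T hT).1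
      have : CompactSpace T := isCompact_iff_compactSpace.1 hTc.isCompact
      exact ⟨(hval isClosed_frontier).isClosedMap _ hTc,
        (h𝒯 V hV' T hT).2.image .subtypeVal⟩
    · intro K hK hd
      have := hcomp hK
      refine (prod_of_forall_disjoint (X := K) (E := ℝ) (F := Fin m → ℝ)
        (𝒮 := (fun V => Subtype.val ⁻¹' frontier V) '' 𝒱) (h𝒱.image _) ?_ ?_ ?_).congr_finrank
          (by simp)
      · rintro _ ⟨V, -, rfl⟩
        exact isClosed_frontier.preimage continuous_subtype_val
      · rintro _ ⟨V, hV', rfl⟩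
        have hKV : IsClosed (Subtype.val ⁻¹' K : Set (frontier V)) :=
          hK.preimage continuous_subtype_val
        have : CompactSpace (Subtype.val ⁻¹' K : Set (frontier V)) :=
          isCompact_iff_compactSpace.1 hKV.isCompact
        have h1 := (hK𝒯 V hV' _ hKV fun T hT => ?_).image (e := Subtype.val) .subtypeVal
        · have : CompactSpace (Subtype.val '' (Subtype.val ⁻¹' K : Set (frontier V)) : Set X) :=
            hcomp ((hval isClosed_frontier).isClosedMap _ hKV)
          have h2 := h1.preimage (hval hK)
          rwa [Subtype.image_preimage_coe, preimage_inter, Subtype.coe_preimage_self,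
            inter_univ] at h2
        · refine Set.disjoint_left.2 fun z hz hzT => Set.disjoint_left.1
            (hd (Subtype.val '' T) ?_) hz (mem_image_of_mem _ hzT)
          simp only [mem_iUnion]
          exact ⟨V, hV', mem_image_of_mem _ hT⟩
      · intro L hL hLd
        have hL' : IsClosed (Subtype.val '' L : Set X) := (hval hK).isClosedMap _ hL
        have := hcomp hL'
        have h1 := (real_of_separating (fun V h => (hV V h).1) hsep hL' fun V hV' => by
          rw [Set.disjoint_left]
          rintro _ ⟨z, hz, rfl⟩ hzV
          exact Set.disjoint_left.1 (hLd _ (mem_image_of_mem _ hV')) hz hzV).preimage (hval hK)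
        rwa [preimage_image_eq _ Subtype.val_injective] at h1

/-- The product with an interval raises the dimension by at most one. -/
lemma prod_unitInterval {n : ℕ} {X : Type u} [TopologicalSpace X] [CompactSpace X]
    [TopologicalSpace.MetrizableSpace X] (h : NonvanishingDense X (Fin n → ℝ)) :
    NonvanishingDense (X × unitInterval) (Fin (n + 1) → ℝ) := by
  induction n generalizing X with
  | zero =>
    have := h.isEmpty
    exact .of_isEmpty _ _
  | succ n ih =>
    obtain ⟨𝒱, h𝒱, hV, hsep⟩ := (h.congr_finrank (F := ℝ × (Fin n → ℝ)) (by
      simp [add_comm])).exists_countable_separating_frontier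
    obtain ⟨D, hDc, hD⟩ := TopologicalSpace.exists_countable_dense unitInterval
    let 𝒲 : Set (Set (X × unitInterval)) := (· ×ˢ univ) '' 𝒱 ∪
      ((fun q => univ ×ˢ Iio q) '' D ∪ (fun q => univ ×ˢ Ioi q) '' D)
    refine (prod_of_forall_disjoint (E := ℝ) (F := Fin (n + 1) → ℝ)
      (𝒮 := ((fun V => frontier V ×ˢ univ) '' 𝒱) ∪ (fun q => univ ×ˢ {q}) '' D)
      ((h𝒱.image _).union (hDc.image _)) ?_ ?_ ?_).congr_finrank (by simp)
    · rintro _ (⟨V, -, rfl⟩ | ⟨q, -, rfl⟩)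
      · exact isClosed_frontier.prod isClosed_univ
      · exact isClosed_univ.prod isClosed_singleton
    · rintro _ (⟨V, hV', rfl⟩ | ⟨q, -, rfl⟩)
      · have : CompactSpace (frontier V) :=
          isCompact_iff_compactSpace.1 isClosed_frontier.isCompact
        have := (ih (hV V hV').2).range (e := Prod.map Subtype.val id)
          (IsEmbedding.subtypeVal.prodMap .id)
        rwa [range_prodMap, Subtype.range_val, range_id] at this
      · have := h.range (e := fun x : X => (x, q)) (isEmbedding_prodMkLeft q)
        rwa [show Set.range (fun x : X => (x, q)) = univ ×ˢ {q} by ext ⟨a, b⟩; simp [eq_comm]]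
          at this
    · intro K hK hd
      refine real_of_separating (𝒱 := 𝒲) ?_ ?_ hK ?_
      · rintro _ (⟨V, hV', rfl⟩ | ⟨q, -, rfl⟩ | ⟨q, -, rfl⟩)
        · exact (hV V hV').1.prod isOpen_univ
        · exact isOpen_univ.prod isOpen_Iio
        · exact isOpen_univ.prod isOpen_Ioi
      · rintro ⟨x, s⟩ ⟨y, t⟩ hne
        by_cases hxy : x = y
        · have hst : s ≠ t := fun h => hne (by rw [hxy, h])
          rcases lt_or_gt_of_ne hst with h | h
          · obtain ⟨q, hq, h1, h2⟩ := hD.exists_between h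
            exact ⟨_, .inr (.inl ⟨q, hq, rfl⟩), by simpa using h1, by simpa using h2.le⟩
          · obtain ⟨q, hq, h1, h2⟩ := hD.exists_between h
            exact ⟨_, .inr (.inr ⟨q, hq, rfl⟩), by simpa using h2, by simpa using h1.le⟩
        · obtain ⟨V, hV', hx, hy⟩ := hsep x y hxy
          exact ⟨_, .inl ⟨V, hV', rfl⟩, by simpa using hx, by simpa using hy⟩
      · rintro _ (⟨V, hV', rfl⟩ | ⟨q, hq, rfl⟩ | ⟨q, hq, rfl⟩)
        · simp only [frontier_prod_univ_eq]
          exact hd _ (.inl ⟨V, hV', rfl⟩)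
        · simp only [frontier_univ_prod_eq]
          exact (hd _ (.inr ⟨q, hq, rfl⟩)).mono_right
            (prod_mono_right
            (frontier_lt_subset_eq continuous_id continuous_const))
        · simp only [frontier_univ_prod_eq]
          exact (hd _ (.inr ⟨q, hq, rfl⟩)).mono_right
            (prod_mono_right fun _ hx =>
            (frontier_lt_subset_eq continuous_const continuous_id hx).symm)

end NonvanishingDense

section Suspension

variable {Z : Type u} [TopologicalSpace Z]

lemma continuous_suspMk : Continuous fun p : Z × unitInterval => suspMk Z p.1 p.2 :=
  continuous_quot_mk

instance [CompactSpace Z] : CompactSpace (Susp Z) :=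
  inferInstanceAs (CompactSpace (Quot (suspRel Z)))

lemma suspMk_surjective (x : Susp Z) : ∃ z t, suspMk Z z t = x := by
  obtain ⟨⟨z, t⟩, rfl⟩ := Quot.exists_rep x
  exact ⟨z, t, rfl⟩

lemma suspMk_zero (z w : Z) : suspMk Z z 0 = suspMk Z w 0 :=
  Quot.sound (.inr (.inl ⟨rfl, rfl⟩))

lemma suspMk_one (z w : Z) : suspMk Z z 1 = suspMk Z w 1 :=
  Quot.sound (.inr (.inr ⟨rfl, rfl⟩))

/-- The suspension of a compact metrizable space embeds into a normed space, by a map that depends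
on `t` and, away from the poles, separates the points of the base. -/
lemma exists_isClosedEmbedding_susp (Z : Type u) [TopologicalSpace Z] [CompactSpace Z]
    [TopologicalSpace.MetrizableSpace Z] :
    ∃ κ : Susp Z → ℝ × C(Z, ℝ), IsClosedEmbedding κ ∧ (∀ z t, (κ (suspMk Z z t)).1 = t) ∧
      ∀ z w t, 0 < t → t < 1 → (κ (suspMk Z z t)).2 = (κ (suspMk Z w t)).2 → z = w := by
  let _ := TopologicalSpace.metrizableSpaceMetric Z
  let d : C(Z, C(Z, ℝ)) := ContinuousMap.curry ⟨fun p => dist p.1 p.2, continuous_dist⟩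
  let φ : Z × unitInterval → ℝ × C(Z, ℝ) := fun p => (p.2, ((p.2 : ℝ) * (1 - p.2)) • d p.1)
  have hφ : Continuous φ := by fun_prop
  have hrel : ∀ a b, suspRel Z a b → φ a = φ b := by
    rintro ⟨z, s⟩ ⟨w, t⟩ (h | ⟨h1, h2⟩ | ⟨h1, h2⟩)
    · rw [h]
    · simp_all [φ]
    · simp_all [φ]
  let κ : Susp Z → ℝ × C(Z, ℝ) := Quot.lift φ hrel
  have hsep : ∀ z w t, 0 < t → t < 1 → (κ (suspMk Z z t)).2 = (κ (suspMk Z w t)).2 → z = w := by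
    intro z w t h0 h1 h
    have h' : ((t : ℝ) * (1 - t)) • d z = ((t : ℝ) * (1 - t)) • d w := h
    have ht : (t : ℝ) * (1 - t) ≠ 0 :=
      (mul_pos (unitInterval.coe_pos.2 h0) (sub_pos.2 (unitInterval.coe_lt_one.2 h1))).ne'
    have hd : d z w = d w w := by rw [smul_right_injective _ ht h']
    exact dist_eq_zero.1 (hd.trans (dist_self w))
  refine ⟨κ, Continuous.isClosedEmbedding (continuous_quot_lift hrel hφ) fun x y h => ?_,
    fun _ _ => rfl, hsep⟩
  obtain ⟨z, s, rfl⟩ := suspMk_surjective x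
  obtain ⟨w, t, rfl⟩ := suspMk_surjective y
  obtain rfl : s = t := Subtype.ext (congr_arg Prod.fst h)
  rcases eq_or_ne s 0 with rfl | h0
  · exact suspMk_zero z w
  rcases eq_or_ne s 1 with rfl | h1
  · exact suspMk_one z w
  · rw [hsep z w s (unitInterval.pos_iff_ne_zero.2 h0) (unitInterval.lt_one_iff_ne_one.2 h1)
      (congr_arg Prod.snd h)]

instance [CompactSpace Z] [TopologicalSpace.MetrizableSpace Z] :
    TopologicalSpace.MetrizableSpace (Susp Z) :=
  (exists_isClosedEmbedding_susp Z).choose_spec.1.isEmbedding.metrizableSpace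

lemma isClosedEmbedding_suspMk [CompactSpace Z] [TopologicalSpace.MetrizableSpace Z]
    {σ : unitInterval → unitInterval} (hσ : Continuous σ) (hi : Function.Injective σ)
    (h0 : ∀ t, 0 < σ t) (h1 : ∀ t, σ t < 1) :
    IsClosedEmbedding fun p : Z × unitInterval => suspMk Z p.1 (σ p.2) := by
  obtain ⟨κ, -, hκ1, hκ2⟩ := exists_isClosedEmbedding_susp Z
  refine Continuous.isClosedEmbedding
    (continuous_suspMk.comp (continuous_fst.prodMk (hσ.comp continuous_snd))) ?_
  rintro ⟨z, s⟩ ⟨w, t⟩ h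
  obtain rfl : s = t := hi (Subtype.ext (by simpa [hκ1] using congr_arg (fun x => (κ x).1) h))
  rw [hκ2 z w (σ s) (h0 s) (h1 s) (congr_arg (fun x => (κ x).2) h)]

/-- The affine parametrization of `[c, 1 - c]` by the unit interval. -/
def shrink (c : ℝ) (hc : 0 < c) (hc' : c < 1 / 2) (t : unitInterval) : unitInterval :=
  ⟨c + t * (1 - 2 * c), by
    have := t.2.1
    have : 0 ≤ 1 - 2 * c := by linarith
    positivity, by nlinarith [t.2.1, t.2.2]⟩

lemma isClosedEmbedding_suspMk_shrink [CompactSpace Z] [TopologicalSpace.MetrizableSpace Z]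
    {c : ℝ} (hc : 0 < c) (hc' : c < 1 / 2) :
    IsClosedEmbedding fun p : Z × unitInterval => suspMk Z p.1 (shrink c hc hc' p.2) := by
  refine isClosedEmbedding_suspMk ?_ (fun s t h => ?_) (fun t => ?_) fun t => ?_
  · unfold shrink
    fun_prop
  · have h' : c + (s : ℝ) * (1 - 2 * c) = c + t * (1 - 2 * c) := congr_arg Subtype.val h
    have hne : 1 - 2 * c ≠ 0 := by linarith
    exact Subtype.ext (mul_right_cancel₀ hne (add_left_cancel h'))
  · refine unitInterval.coe_pos.1 ?_
    show 0 < c + (t : ℝ) * (1 - 2 * c)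
    nlinarith [t.2.1, t.2.2]
  · refine unitInterval.coe_lt_one.1 ?_
    show c + (t : ℝ) * (1 - 2 * c) < 1
    nlinarith [t.2.1, t.2.2]

lemma exists_shrink_eq {c : ℝ} (hc : 0 < c) (hc' : c < 1 / 2) {t : unitInterval}
    (h : c ≤ t) (h' : (t : ℝ) ≤ 1 - c) : ∃ s, shrink c hc hc' s = t := by
  have hne : 0 < 1 - 2 * c := by linarith
  refine ⟨⟨(t - c) / (1 - 2 * c), div_nonneg (by linarith) hne.le,
    (div_le_one hne).2 (by linarith)⟩, Subtype.ext ?_⟩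
  show c + ((t : ℝ) - c) / (1 - 2 * c) * (1 - 2 * c) = t
  rw [div_mul_cancel₀ _ hne.ne']
  ring

namespace NonvanishingDense

lemma prod_unitInterval_of_susp [CompactSpace Z] [TopologicalSpace.MetrizableSpace Z] {E : Type*}
    [NormedAddCommGroup E] [NormedSpace ℝ E] [FiniteDimensional ℝ E]
    (h : NonvanishingDense (Susp Z) E) : NonvanishingDense (Z × unitInterval) E :=
  h.of_isClosedEmbedding (isClosedEmbedding_suspMk_shrink (c := 1 / 3) (by norm_num) (by norm_num))

lemma susp [Nonempty Z] [CompactSpace Z] [TopologicalSpace.MetrizableSpace Z] {n : ℕ}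
    (h : NonvanishingDense (Z × unitInterval) (Fin (n + 1) → ℝ)) :
    NonvanishingDense (Susp Z) (Fin (n + 1) → ℝ) := by
  obtain ⟨z₀⟩ := ‹Nonempty Z›
  have hc (m : ℕ) : 0 < 1 / ((m : ℝ) + 3) := by positivity
  have hc' (m : ℕ) : 1 / ((m : ℝ) + 3) < 1 / 2 :=
    one_div_lt_one_div_of_lt two_pos (by linarith [m.cast_nonneg (α := ℝ)])
  let e : ℕ → Z × unitInterval → Susp Z := fun m p => suspMk Z p.1 (shrink _ (hc m) (hc' m) p.2)
  have he (m : ℕ) : IsClosedEmbedding (e m) := isClosedEmbedding_suspMk_shrink _ _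
  have hpt (x : Susp Z) : NonvanishingDense ({x} : Set (Susp Z)) (Fin (n + 1) → ℝ) :=
    ((real_of_totallyDisconnectedSpace _).prod_right (Fin n → ℝ)).congr_finrank
      (by simp [add_comm])
  refine of_sUnion (𝒮 := {{suspMk Z z₀ 0}, {suspMk Z z₀ 1}} ∪ Set.range fun m => Set.range (e m))
    (.union (by simp) (countable_range _)) ?_ ?_ ?_
  · rintro _ ((rfl | rfl) | ⟨m, rfl⟩)
    · exact isClosed_singleton
    · exact isClosed_singleton
    · exact (he m).isClosed_range
  · rintro _ ((rfl | rfl) | ⟨m, rfl⟩)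
    · exact hpt _
    · exact hpt _
    · exact h.range (he m).isEmbedding
  · refine eq_univ_of_forall fun x => ?_
    obtain ⟨z, t, rfl⟩ := suspMk_surjective x
    rcases eq_or_ne t 0 with rfl | h0
    · exact ⟨_, .inl (.inl rfl), suspMk_zero z z₀⟩
    rcases eq_or_ne t 1 with rfl | h1
    · exact ⟨_, .inl (.inr rfl), suspMk_one z z₀⟩
    have h0' := unitInterval.coe_pos.2 (unitInterval.pos_iff_ne_zero.2 h0)
    have h1' := unitInterval.coe_lt_one.2 (unitInterval.lt_one_iff_ne_one.2 h1)
    obtain ⟨m, hm⟩ := exists_nat_one_div_lt (lt_min h0' (sub_pos.2 h1'))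
    have hm' : 1 / ((m : ℝ) + 3) ≤ min (t : ℝ) (1 - t) :=
      (one_div_le_one_div_of_le (by positivity) (by linarith)).trans hm.le
    obtain ⟨s, hs⟩ := exists_shrink_eq (hc m) (hc' m) (t := t) (hm'.trans (min_le_left _ _))
      (by linarith [hm'.trans (min_le_right _ _)])
    exact ⟨_, .inr ⟨m, rfl⟩, (z, s), by simp only [e, hs]⟩

end NonvanishingDense

end Suspension

/-- A nonvanishing perturbation of `(x, t) ↦ (f x, 2 t - 1)`. -/
lemma NonvanishingDense.exists_prod_unitInterval {X E : Type*} [TopologicalSpace X]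
    [NormedAddCommGroup E] (h : NonvanishingDense (X × unitInterval) (E × ℝ)) (f : C(X, E))
    {η : ℝ} (hη : 0 < η) (hη1 : η ≤ 1) :
    ∃ (G : C(X × unitInterval, E)) (g : C(X × unitInterval, ℝ)), (∀ p, G p = 0 → g p ≠ 0) ∧
      (∀ p, ‖G p - f p.1‖ < η) ∧ (∀ x, g (x, 0) < 0) ∧ ∀ x, 0 < g (x, 1) := by
  obtain ⟨H, hH0, hH⟩ := h ⟨fun p => (f p.1, 2 * (p.2 : ℝ) - 1), by fun_prop⟩ η hη
  have hH2 (p) : |(H p).2 - (2 * (p.2 : ℝ) - 1)| < η := (norm_snd_le _).trans_lt (hH p)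
  refine ⟨⟨fun p => (H p).1, by fun_prop⟩, ⟨fun p => (H p).2, by fun_prop⟩,
    fun p h1 h2 => hH0 p (Prod.ext h1 h2), fun p => (norm_fst_le _).trans_lt (hH p),
    fun x => ?_, fun x => ?_⟩
  · have := (abs_lt.1 (hH2 (x, 0))).2
    simp only [Set.Icc.coe_zero] at this
    simp only [ContinuousMap.coe_mk]
    linarith
  · have := (abs_lt.1 (hH2 (x, 1))).1
    simp only [Set.Icc.coe_one] at this
    simp only [ContinuousMap.coe_mk]
    linarith

lemma exists_pos_forall_le_of_compactSpace {X : Type*} [TopologicalSpace X] [CompactSpace X]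
    {f : X → ℝ} (hf : Continuous f) (h : ∀ x, 0 < f x) : ∃ δ > 0, ∀ x, δ ≤ f x := by
  obtain ⟨δ, hδ, h'⟩ := isCompact_univ.exists_forall_le' hf.continuousOn fun x _ => h x
  exact ⟨δ, hδ, fun x => h' x (mem_univ x)⟩

namespace NonvanishingDense

lemma prod_univ {X Y E : Type*} [TopologicalSpace X] [TopologicalSpace Y] [NormedAddCommGroup E]
    [NormedSpace ℝ E] [FiniteDimensional ℝ E] {S : Set X} [NormalSpace (S × Y)]
    (h : NonvanishingDense (S × Y) E) :
    NonvanishingDense (S ×ˢ (univ : Set Y) : Set (X × Y)) E := by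
  have := h.range (IsEmbedding.subtypeVal.prodMap IsEmbedding.id)
  rwa [range_prodMap, Subtype.range_val, range_id] at this

lemma isEmpty_of_prod_unitInterval {X : Type*} [TopologicalSpace X]
    (h : NonvanishingDense (X × unitInterval) ℝ) : IsEmpty X := by
  refine ⟨fun x => ?_⟩
  obtain ⟨g, hg0, hg⟩ := h ⟨fun p => 2 * (p.2 : ℝ) - 1, by fun_prop⟩ 1 one_pos
  have h0 := (abs_lt.1 (hg (x, 0))).2
  have h1 := (abs_lt.1 (hg (x, 1))).1
  simp only [ContinuousMap.coe_mk, Set.Icc.coe_zero, Set.Icc.coe_one] at h0 h1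
  have hc : Continuous fun t => g (x, t) := by fun_prop
  obtain ⟨t, ht⟩ := mem_range_of_exists_le_of_exists_ge hc (c := 0) ⟨0, by linarith⟩
    ⟨1, by linarith⟩
  exact hg0 _ ht

/-- The case `n ≥ 3` of the dimension formula for products with an interval. -/
lemma of_prod_unitInterval_add_three {m : ℕ} {X : Type u} [TopologicalSpace X] [CompactSpace X]
    [TopologicalSpace.MetrizableSpace X]
    (hI : NonvanishingDense (X × unitInterval) (Fin (m + 3 + 1) → ℝ)) :
    NonvanishingDense X (Fin (m + 3) → ℝ) := by
  have hX : NonvanishingDense X (Fin (m + 3 + 1) → ℝ) :=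
    hI.of_isClosedEmbedding (e := fun x => (x, 0))
      (Continuous.isClosedEmbedding (by fun_prop) fun _ _ h => congr_arg Prod.fst h)
  obtain ⟨𝒮, hc, hS, h𝒮⟩ := exists_decomposition 2
    (hX.congr_finrank (F := (Fin (m + 2) → ℝ) × (Fin 2 → ℝ)) (by simp))
  have hSI (S) (hmem : S ∈ 𝒮) : NonvanishingDense (S ×ˢ (univ : Set unitInterval) : Set _)
      (Fin (m + 3) → ℝ) := by
    have : CompactSpace S := isCompact_iff_compactSpace.1 (hS S hmem).1.isCompact
    exact (hS S hmem).2.prod_unitInterval.prod_univ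
  intro f ε hε
  obtain ⟨G, g, hGg, hGf, hg0, hg1⟩ := (hI.congr_finrank (F := (Fin (m + 3) → ℝ) × ℝ)
    (by simp)).exists_prod_unitInterval f (η := min (ε / 2) 1) (by positivity) (min_le_right _ _)
  obtain ⟨δ, hδ, hδG⟩ := exists_pos_forall_le_of_compactSpace
    (f := fun p => max ‖G p‖ |g p|) (by fun_prop) fun p => by
      by_cases h : G p = 0
      · exact lt_max_of_lt_right (abs_pos.2 (hGg p h))
      · exact lt_max_of_lt_left (norm_pos_iff.2 h)
  have hρ : 0 < min δ (ε / 2) := by positivity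
  obtain ⟨u, hu0, hu⟩ := exists_forall_mem_ne_zero
    (𝒮 := (fun S => S ×ˢ (univ : Set unitInterval)) '' 𝒮) (hc.image _)
    (by rintro _ ⟨S, hmem, rfl⟩; exact (hS S hmem).1.prod isClosed_univ)
    (by rintro _ ⟨S, hmem, rfl⟩; exact hSI S hmem) G hρ
  let C : Set X := Prod.fst '' {p | u p = 0}
  have hC : IsClosed C :=
    ((isClosed_eq u.continuous continuous_const).isCompact.image continuous_fst).isClosed
  have hCd : NonvanishingDense C (Fin 2 → ℝ) := by
    refine h𝒮 C hC fun S hmem => disjoint_left.2 ?_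
    rintro _ ⟨p, hp, rfl⟩ hpS
    exact hu0 _ ⟨S, hmem, rfl⟩ p ⟨hpS, mem_univ _⟩ hp
  have hCI : NonvanishingDense (C ×ˢ (univ : Set unitInterval) : Set _) (Fin (m + 3) → ℝ) := by
    have : CompactSpace C := isCompact_iff_compactSpace.1 hC.isCompact
    exact ((hCd.prod_unitInterval.prod_right (Fin m → ℝ)).congr_finrank
      (by simp [add_comm])).prod_univ
  obtain ⟨v, hv0, hv⟩ := exists_forall_mem_ne_zero (𝒮 := {C ×ˢ (univ : Set unitInterval)})
    (countable_singleton _) (by rintro _ rfl; exact hC.prod isClosed_univ)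
    (by rintro _ rfl; exact hCI) G hρ
  let χ : X × unitInterval → ℝ := fun p => max 0 (min 1 ((g p / δ + 1) / 2))
  have hχ0 (p) : 0 ≤ χ p := le_max_left _ _
  have hχ1 (p) : χ p ≤ 1 := max_le zero_le_one (min_le_left _ _)
  let w : C(X × unitInterval, Fin (m + 3) → ℝ) :=
    ⟨fun p => χ p • u p + (1 - χ p) • v p, by fun_prop⟩
  have hw (p) : ‖w p - G p‖ < min δ (ε / 2) := by
    rw [← mem_ball_iff_norm]
    exact convex_ball (G p) _ (mem_ball_iff_norm.2 (hu p)) (mem_ball_iff_norm.2 (hv p)) (hχ0 p)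
      (sub_nonneg.2 (hχ1 p)) (by ring)
  have hw0 (p) (h : w p = 0) : (u p = 0 ∧ δ ≤ g p) ∨ (v p = 0 ∧ g p ≤ -δ) := by
    have hG : ‖G p‖ < δ := by
      simpa [h] using (hw p).trans_le (min_le_left _ _)
    have hg : δ ≤ |g p| := by simpa [hG.not_ge] using hδG p
    have h' : χ p • u p + (1 - χ p) • v p = 0 := h
    rcases le_abs'.1 hg with hg | hg
    · have : χ p = 0 := by
        refine max_eq_left ((min_le_right _ _).trans ?_)
        have : g p / δ ≤ -1 := by rw [div_le_iff₀ hδ]; linarith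
        linarith
      right
      simpa [this, hg] using h'
    · have : χ p = 1 := by
        have : 1 ≤ g p / δ := by rwa [one_le_div hδ]
        have : 1 ≤ (g p / δ + 1) / 2 := by linarith
        simp [χ, this]
      left
      simpa [this, hg] using h'
  have hL : IsClosed (Prod.fst '' {p | u p = 0 ∧ δ ≤ g p}) :=
    (((isClosed_eq u.continuous continuous_const).inter
      (isClosed_le continuous_const g.continuous)).isCompact.image continuous_fst).isClosed
  have hM : IsClosed (Prod.fst '' {p | v p = 0 ∧ g p ≤ -δ}) :=
    (((isClosed_eq v.continuous continuous_const).inter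
      (isClosed_le g.continuous continuous_const)).isCompact.image continuous_fst).isClosed
  obtain ⟨τ, hτ0, hτ1, hτ⟩ := exists_continuous_zero_one_of_isClosed hL hM <| disjoint_left.2 <| by
    rintro _ ⟨p, hp, rfl⟩ ⟨q, hq, hqp⟩
    exact hv0 _ rfl q ⟨⟨p, hp.1, hqp.symm⟩, mem_univ _⟩ hq.1
  let s : C(X, unitInterval) := ⟨fun x => ⟨τ x, hτ x⟩, by fun_prop⟩
  refine ⟨⟨fun x => w (x, s x), by fun_prop⟩, fun x hx => ?_, fun x => ?_⟩
  · rcases hw0 _ hx with ⟨h1, h2⟩ | ⟨h1, h2⟩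
    · have : s x = 0 := Subtype.ext (hτ0 ⟨_, ⟨h1, h2⟩, rfl⟩)
      rw [this] at h2
      linarith [hg0 x]
    · have : s x = 1 := Subtype.ext (hτ1 ⟨_, ⟨h1, h2⟩, rfl⟩)
      rw [this] at h2
      linarith [hg1 x]
  · calc ‖w (x, s x) - f x‖ ≤ ‖w (x, s x) - G (x, s x)‖ + ‖G (x, s x) - f x‖ :=
          norm_sub_le_norm_sub_add_norm_sub _ _ _
      _ < ε / 2 + ε / 2 := add_lt_add ((hw _).trans_le (min_le_right _ _))
          ((hGf (x, s x)).trans_le (min_le_left _ _))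
      _ = ε := add_halves ε

end NonvanishingDense

section RCLike

variable {𝕜 : Type*} [RCLike 𝕜]

open ComplexConjugate

lemma RCLike.re_mul_conj_pos {z w : 𝕜} (h : ‖z - w‖ < ‖w‖) : 0 < RCLike.re (z * conj w) := by
  have h1 : z * conj w = (z - w) * conj w + ((‖w‖ ^ 2 : ℝ) : 𝕜) := by
    rw [sub_mul, RCLike.mul_conj w]
    push_cast
    ring
  have h2 := (abs_le.1 (RCLike.abs_re_le_norm ((z - w) * conj w))).1
  rw [norm_mul, RCLike.norm_conj] at h2
  rw [h1, map_add, RCLike.ofReal_re]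
  nlinarith [norm_nonneg (z - w)]

/-- A function on a closed set with values in the right half plane extends to a nonvanishing
function. -/
lemma exists_ne_zero_extension {X : Type*} [TopologicalSpace X] [CompactSpace X] [T2Space X]
    {A : Set X} (hA : IsClosed A) {c : X → 𝕜} (hc : ContinuousOn c A)
    (hpos : ∀ x ∈ A, 0 < RCLike.re (c x)) :
    ∃ d : C(X, 𝕜), (∀ x, d x ≠ 0) ∧ ∀ x ∈ A, d x = c x := by
  obtain ⟨δ, hδ, hδA⟩ := hA.isCompact.exists_forall_le'
    (RCLike.continuous_re.comp_continuousOn hc) hpos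
  obtain ⟨e, he⟩ := ContinuousMap.exists_restrict_eq hA ⟨A.domRestrict c, hc.domRestrict⟩
  have he' (x) (hx : x ∈ A) : e x = c x := congr($he ⟨x, hx⟩)
  refine ⟨⟨fun x => e x + ((max (RCLike.re (e x)) δ - RCLike.re (e x) : ℝ) : 𝕜), ?_⟩,
    fun x hx => ?_, fun x hx => ?_⟩
  · have := RCLike.continuous_re (K := 𝕜)
    have := RCLike.continuous_ofReal (K := 𝕜)
    fun_prop
  · have h := congr_arg RCLike.re hx
    simp only [ContinuousMap.coe_mk, map_add, RCLike.ofReal_re, map_zero, add_sub_cancel] at h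
    exact (hδ.trans_le (le_max_right _ _)).ne' h
  · have : δ ≤ RCLike.re (e x) := by rw [he' x hx]; exact hδA x hx
    rw [ContinuousMap.coe_mk, max_eq_left this, sub_self, RCLike.ofReal_zero, add_zero, he' x hx]

/-- Let `r` and `r'` be positive eigenvalues of the Hermitian matrices `H = [[g, z], [conj z, -g]]`
and `H' = [[g', z'], [conj z', -g']]`. An `r`-eigenvector of `H` that is a `-r'`-eigenvector of `H'`
vanishes, provided that `H` and `H'` are close. -/
lemma eq_zero_of_mul_add_mul_eq {a b z z' : 𝕜} {g g' r r' : ℝ} (hr : 0 < r) (hr' : 0 < r')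
    (h1 : g * a + z * b = r * a) (h2 : conj z * a - g * b = r * b)
    (h1' : (r' + g') * a + z' * b = 0) (h2' : conj z' * a + (r' - g') * b = 0)
    (hlt : (g - g') ^ 2 + ‖z - z'‖ ^ 2 < r ^ 2) : a = 0 ∧ b = 0 := by
  have hz : (z - z') * (conj z - conj z') = ((‖z - z'‖ ^ 2 : ℝ) : 𝕜) := by
    rw [← map_sub, RCLike.mul_conj]
    push_cast
    rfl
  have hne : (((r + r') ^ 2 - ((g - g') ^ 2 + ‖z - z'‖ ^ 2) : ℝ) : 𝕜) ≠ 0 := by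
    refine RCLike.ofReal_ne_zero.2 (ne_of_gt ?_)
    nlinarith
  push_cast at hz hne
  refine ⟨(mul_eq_zero.1 (?_ : _ * a = 0)).resolve_left hne,
    (mul_eq_zero.1 (?_ : _ * b = 0)).resolve_left hne⟩
  · linear_combination a * hz - ((r : 𝕜) + r') * (h1 - h1') - ((g : 𝕜) - g') * (h1 - h1') -
      (z - z') * (h2 - h2')
  · linear_combination ((g : 𝕜) - g') * (h2 - h2') - ((r : 𝕜) + r') * (h2 - h2') -
      (conj z - conj z') * (h1 - h1') + b * hz

/-- The matrix `[[g, z], [conj z, -g]]` has a nowhere vanishing continuous field `(a, b)` of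
eigenvectors for the eigenvalue `r`, where `a = f c` on the set `A` for some nonvanishing `c`. -/
def HasEigenfield {X : Type*} [TopologicalSpace X] (A : Set X) (f z : C(X, 𝕜)) (g r : C(X, ℝ)) :
    Prop :=
  ∃ a b c : C(X, 𝕜), (∀ x, a x = 0 → b x ≠ 0) ∧ (∀ x, g x * a x + z x * b x = r x * a x) ∧
    (∀ x, conj (z x) * a x - g x * b x = r x * b x) ∧ (∀ x, c x ≠ 0) ∧ ∀ x ∈ A, a x = f x * c x

namespace HasEigenfield

variable {X : Type*} [TopologicalSpace X] {A : Set X} {f z z' : C(X, 𝕜)} {g g' r r' : C(X, ℝ)}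

lemma sq_eq_add_mul_conj (hr : ∀ x, r x ^ 2 = g x ^ 2 + ‖z x‖ ^ 2) (x : X) :
    (r x : 𝕜) ^ 2 = (g x : 𝕜) ^ 2 + z x * conj (z x) := by
  rw [RCLike.mul_conj]
  exact_mod_cast congr_arg (RCLike.ofReal (K := 𝕜)) (hr x)

lemma of_neg [CompactSpace X] [T2Space X] (hA : IsClosed A)
    (hr : ∀ x, r x ^ 2 = g x ^ 2 + ‖z x‖ ^ 2) (hr0 : ∀ x, 0 < r x) (hg : ∀ x, g x < 0)
    (hzf : ∀ x ∈ A, ‖z x - f x‖ < ‖f x‖) : HasEigenfield A f z g r := by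
  have hf0 (x) (hx : x ∈ A) : f x ≠ 0 := norm_pos_iff.1 ((norm_nonneg _).trans_lt (hzf x hx))
  obtain ⟨c, hc0, hc⟩ := exists_ne_zero_extension (c := fun x => z x / f x) hA
    (ContinuousOn.div (map_continuous z).continuousOn (map_continuous f).continuousOn hf0)
    fun x hx => by
      have h3 := RCLike.re_mul_conj_pos (hzf x hx)
      have h4 : z x / f x = z x * conj (f x) * (((‖f x‖ ^ 2)⁻¹ : ℝ) : 𝕜) := by
        rw [RCLike.ofReal_inv, RCLike.ofReal_pow, ← RCLike.mul_conj, mul_inv, ← mul_assoc,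
          mul_right_comm, mul_inv_cancel_right₀ ((map_ne_zero _).2 (hf0 x hx)), div_eq_mul_inv]
      have := norm_pos_iff.2 (hf0 x hx)
      rw [h4, RCLike.re_mul_ofReal]
      positivity
  refine ⟨z, ⟨fun x => ((r x - g x : ℝ) : 𝕜), RCLike.continuous_ofReal.comp (by fun_prop)⟩,
    c, fun x _ => RCLike.ofReal_ne_zero.2 (by linarith [hr0 x, hg x]), fun x => ?_,
    fun x => ?_, hc0, fun x hx => ?_⟩
  · simp only [ContinuousMap.coe_mk]
    push_cast
    ring
  · simp only [ContinuousMap.coe_mk]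
    push_cast
    linear_combination -sq_eq_add_mul_conj hr x
  · rw [hc x hx, mul_div_cancel₀ _ (hf0 x hx)]

lemma add_pos_of_ne_zero (hr : ∀ x, r x ^ 2 = g x ^ 2 + ‖z x‖ ^ 2) (hr0 : ∀ x, 0 < r x) {x : X}
    (h : z x ≠ 0) : 0 < r x + g x := by
  have := hr x
  have := hr0 x
  have : 0 < ‖z x‖ := norm_pos_iff.2 h
  nlinarith

lemma step [CompactSpace X] [T2Space X] (hA : IsClosed A)
    (hr : ∀ x, r x ^ 2 = g x ^ 2 + ‖z x‖ ^ 2) (hr0 : ∀ x, 0 < r x)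
    (hr' : ∀ x, r' x ^ 2 = g' x ^ 2 + ‖z' x‖ ^ 2) (hr0' : ∀ x, 0 < r' x)
    (hlt : ∀ x, (g x - g' x) ^ 2 + ‖z x - z' x‖ ^ 2 < r x ^ 2)
    (hzz' : ∀ x ∈ A, ‖z' x - z x‖ < ‖z x‖) (h : HasEigenfield A f z g r) :
    HasEigenfield A f z' g' r' := by
  obtain ⟨a, b, c, hab, h1, h2, hc, hac⟩ := h
  have hpos (x) (hx : x ∈ A) : 0 < r x + g x :=
    add_pos_of_ne_zero hr hr0 (norm_pos_iff.1 ((norm_nonneg _).trans_lt (hzz' x hx)))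
  have hof := RCLike.continuous_ofReal (K := 𝕜)
  have hconj := RCLike.continuous_conj (K := 𝕜)
  let k (x : X) : 𝕜 := r' x + g' x + z' x * conj (z x) * (((r x + g x)⁻¹ : ℝ) : 𝕜)
  have hk : ContinuousOn k A := by
    have h3 : ContinuousOn (fun x => (((r x + g x)⁻¹ : ℝ) : 𝕜)) A :=
      hof.comp_continuousOn (ContinuousOn.inv₀ (by fun_prop) fun x hx => (hpos x hx).ne')
    have h4 : Continuous fun x => z' x * conj (z x) := by fun_prop
    have h5 : Continuous fun x => (r' x : 𝕜) + g' x := by fun_prop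
    exact h5.continuousOn.add (h4.continuousOn.mul h3)
  obtain ⟨d, hd0, hd⟩ := exists_ne_zero_extension hA hk fun x hx => by
    have h3 := RCLike.re_mul_conj_pos (hzz' x hx)
    have h4 := inv_pos.2 (hpos x hx)
    have h5 : 0 ≤ r' x + g' x := by
      have := hr' x
      have := hr0' x
      nlinarith [sq_nonneg ‖z' x‖]
    simp only [k, map_add, RCLike.ofReal_re, RCLike.re_mul_ofReal]
    exact add_pos_of_nonneg_of_pos h5 (mul_pos h3 h4)
  refine ⟨⟨fun x => (r' x + g' x) * a x + z' x * b x, by fun_prop⟩,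
    ⟨fun x => conj (z' x) * a x + (r' x - g' x) * b x, by fun_prop⟩, c * d,
    fun x h1' h2' => ?_, fun x => ?_, fun x => ?_, fun x => mul_ne_zero (hc x) (hd0 x),
    fun x hx => ?_⟩
  · obtain ⟨ha, hb⟩ := eq_zero_of_mul_add_mul_eq (hr0 x) (hr0' x) (h1 x) (h2 x) h1' h2' (hlt x)
    exact hab x ha hb
  · simp only [ContinuousMap.coe_mk]
    linear_combination -a x * sq_eq_add_mul_conj hr' x
  · simp only [ContinuousMap.coe_mk]
    linear_combination -b x * sq_eq_add_mul_conj hr' x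
  · have h3 : ((r x + g x : ℝ) : 𝕜) ≠ 0 := RCLike.ofReal_ne_zero.2 (hpos x hx).ne'
    have h4 : b x = conj (z x) * (((r x + g x)⁻¹ : ℝ) : 𝕜) * a x := by
      rw [RCLike.ofReal_inv, mul_right_comm, eq_mul_inv_iff_mul_eq₀ h3]
      push_cast
      linear_combination -h2 x
    simp only [ContinuousMap.coe_mk, ContinuousMap.mul_apply, hd x hx, k]
    rw [h4, ← mul_assoc (f x), ← hac x hx]
    ring

lemma exists_ne_zero (hr0 : ∀ x, 0 < r x) (hg : ∀ x, 0 < g x) (h : HasEigenfield A f z g r) :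
    ∃ h : C(X, 𝕜), (∀ x, h x ≠ 0) ∧ ∀ x ∈ A, h x = f x := by
  obtain ⟨a, b, c, hab, -, h2, hc, hac⟩ := h
  refine ⟨⟨fun x => a x / c x, (map_continuous a).div (map_continuous c) hc⟩, fun x h => ?_,
    fun x hx => ?_⟩
  · have ha : a x = 0 := (div_eq_zero_iff.1 h).resolve_right (hc x)
    have h3 := h2 x
    have h4 : ((r x + g x : ℝ) : 𝕜) ≠ 0 := RCLike.ofReal_ne_zero.2 (add_pos (hr0 x) (hg x)).ne'
    refine hab x ha ((mul_eq_zero.1 ?_).resolve_left h4)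
    rw [ha, mul_zero] at h3
    push_cast
    linear_combination -h3
  · rw [ContinuousMap.coe_mk, hac x hx, mul_div_cancel_right₀ _ (hc x)]

end HasEigenfield

/-- If `(f, -1)` and `(f, 1)` are homotopic as nonvanishing maps, up to perturbation, then `f`
can be made nonvanishing without changing its large values. -/
lemma exists_ne_zero_eq_of_large {X : Type*} [TopologicalSpace X] [CompactSpace X] [T2Space X]
    {f : C(X, 𝕜)} {z : C(X × unitInterval, 𝕜)} {g : C(X × unitInterval, ℝ)} {η : ℝ}
    (hη : 0 < η) (hzg : ∀ p, z p = 0 → g p ≠ 0) (hz : ∀ p, ‖z p - f p.1‖ < η)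
    (hg0 : ∀ x, g (x, 0) < 0) (hg1 : ∀ x, 0 < g (x, 1)) :
    ∃ h : C(X, 𝕜), (∀ x, h x ≠ 0) ∧ ∀ x, 3 * η ≤ ‖f x‖ → h x = f x := by
  have hA : IsClosed {x | 3 * η ≤ ‖f x‖} := isClosed_le continuous_const (by fun_prop)
  have hzz {x} (hx : 3 * η ≤ ‖f x‖) (s t) : ‖z (x, s) - z (x, t)‖ < ‖z (x, t)‖ := by
    have h1 := norm_sub_norm_le (f x) (z (x, t))
    have h2 := hz (x, t)
    rw [norm_sub_rev] at h1
    calc ‖z (x, s) - z (x, t)‖ ≤ ‖z (x, s) - f x‖ + ‖z (x, t) - f x‖ := by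
          rw [norm_sub_rev (z (x, t))]
          exact norm_sub_le_norm_sub_add_norm_sub _ _ _
      _ < ‖z (x, t)‖ := by linarith [hz (x, s)]
  let r : C(X × unitInterval, ℝ) := ⟨fun p => √(g p ^ 2 + ‖z p‖ ^ 2), by fun_prop⟩
  have hr (p) : r p ^ 2 = g p ^ 2 + ‖z p‖ ^ 2 := Real.sq_sqrt (by positivity)
  have hr0 (p) : 0 < r p := by
    refine Real.sqrt_pos.2 ?_
    by_cases h : z p = 0
    · have := hzg p h
      positivity
    · positivity
  let ι (t : unitInterval) : C(X, X × unitInterval) := ⟨fun x => (x, t), by fun_prop⟩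
  let good (t : unitInterval) : Prop :=
    HasEigenfield {x | 3 * η ≤ ‖f x‖} f (z.comp (ι t)) (g.comp (ι t)) (r.comp (ι t))
  have step (t s) (hts : ∀ x, (g (x, t) - g (x, s)) ^ 2 + ‖z (x, t) - z (x, s)‖ ^ 2 < r (x, t) ^ 2)
      (ht : good t) : good s :=
    HasEigenfield.step hA (fun _ => hr _) (fun _ => hr0 _) (fun _ => hr _) (fun _ => hr0 _) hts
      (fun x hx => hzz hx s t) ht
  have hgood0 : good 0 := .of_neg hA (fun _ => hr _) (fun _ => hr0 _) hg0 fun x hx =>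
    (hz (x, 0)).trans_le (by linarith [show 3 * η ≤ ‖f x‖ from hx])
  have hgood1 : good 1 := by
    refine PreconnectedSpace.induction₂' (fun t s => good t → good s) (fun t => ?_)
      ⟨fun _ _ _ h h' => h' ∘ h⟩ 0 1 hgood0
    have key : ∀ᶠ s in 𝓝 t, ∀ x ∈ (univ : Set X),
        (g (x, t) - g (x, s)) ^ 2 + ‖z (x, t) - z (x, s)‖ ^ 2 < r (x, t) ^ 2 ∧
        (g (x, s) - g (x, t)) ^ 2 + ‖z (x, s) - z (x, t)‖ ^ 2 < r (x, s) ^ 2 := by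
      refine isCompact_univ.eventually_forall_of_forall_eventually fun x _ => ?_
      refine (ContinuousAt.eventually_lt (by fun_prop) (by fun_prop) ?_).and
        (ContinuousAt.eventually_lt (by fun_prop) (by fun_prop) ?_)
      all_goals simpa using pow_pos (hr0 (x, t)) 2
    filter_upwards [key] with s hs
    exact ⟨step t s fun x => (hs x (mem_univ x)).1, step s t fun x => (hs x (mem_univ x)).2⟩
  exact hgood1.exists_ne_zero (fun _ => hr0 _) hg1

lemma NonvanishingDense.of_prod_unitInterval_rclike {X : Type*} [TopologicalSpace X]
    [CompactSpace X] [T2Space X] (h : NonvanishingDense (X × unitInterval) (𝕜 × ℝ)) :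
    NonvanishingDense X 𝕜 := by
  intro f ε hε
  obtain ⟨z, g, hzg, hz, hg0, hg1⟩ := h.exists_prod_unitInterval f (η := min (ε / 6) 1)
    (by positivity) (min_le_right _ _)
  obtain ⟨k, hk0, hk⟩ := exists_ne_zero_eq_of_large (η := ε / 6) (by positivity) hzg
    (fun p => (hz p).trans_le (min_le_left _ _)) hg0 hg1
  have hof := RCLike.continuous_ofReal (K := 𝕜)
  have hm (x) : 0 < max ‖f x‖ (ε / 2) := by positivity
  refine ⟨⟨fun x => (max ‖f x‖ (ε / 2) / ‖k x‖) • k x, ?_⟩, fun x => ?_, fun x => ?_⟩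
  · have h0 (x) : ‖k x‖ ≠ 0 := norm_ne_zero_iff.2 (hk0 x)
    fun_prop (disch := exact h0)
  · exact smul_ne_zero (div_pos (hm x) (norm_pos_iff.2 (hk0 x))).ne' (hk0 x)
  · simp only [ContinuousMap.coe_mk]
    have hkx := norm_pos_iff.2 (hk0 x)
    rcases le_or_gt (ε / 2) ‖f x‖ with hx | hx
    · rw [hk x (by linarith)] at hkx ⊢
      rwa [max_eq_left hx, div_self hkx.ne', one_smul, sub_self, norm_zero]
    · calc _ ≤ ‖(max ‖f x‖ (ε / 2) / ‖k x‖) • k x‖ + ‖f x‖ := norm_sub_le _ _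
        _ = ε / 2 + ‖f x‖ := by
          rw [norm_smul, norm_div, norm_norm, div_mul_cancel₀ _ hkx.ne', max_eq_right hx.le,
            Real.norm_of_nonneg (by positivity)]
        _ < ε := by linarith

end RCLike

/-- A product with an interval raises the dimension by at least one. -/
lemma NonvanishingDense.of_prod_unitInterval {n : ℕ} {X : Type u} [TopologicalSpace X]
    [CompactSpace X] [TopologicalSpace.MetrizableSpace X]
    (h : NonvanishingDense (X × unitInterval) (Fin (n + 1) → ℝ)) :
    NonvanishingDense X (Fin n → ℝ) := by
  match n with
  | 0 =>
    have := (h.congr_finrank (F := ℝ) (by simp)).isEmpty_of_prod_unitInterval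
    exact .of_isEmpty _ _
  | 1 =>
    exact ((h.congr_finrank (F := ℝ × ℝ) (by simp)).of_prod_unitInterval_rclike).congr_finrank
      (by simp)
  | 2 =>
    exact ((h.congr_finrank (F := ℂ × ℝ) (by simp)).of_prod_unitInterval_rclike).congr_finrank
      (by simp)
  | m + 3 => exact h.of_prod_unitInterval_add_three

/-- If `Z` is a nonempty compact metrizable space of small inductive dimension `k`, then the
unreduced suspension `ΣZ` is a compact metrizable space of small inductive dimension `k + 1`. -/
theorem suspension_dimension (Z : Type u) [TopologicalSpace Z] [Nonempty Z] [CompactSpace Z]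
    [TopologicalSpace.MetrizableSpace Z] (k : ℕ) (hdim : IndEq Z k) :
    CompactSpace (Susp Z) ∧ TopologicalSpace.MetrizableSpace (Susp Z) ∧
      IndEq (Susp Z) ((k : ℤ) + 1) := by
  refine ⟨inferInstance, inferInstance, ?_⟩
  simp only [IndEq, IndLE, indLEnat_iff_nonvanishingDense] at hdim ⊢
  rw [show ((k : ℤ) + 1).toNat = k + 1 by lia, show ((k : ℤ) - 1 + 1).toNat = k by lia] at hdim
  rw [show ((k : ℤ) + 1 + 1).toNat = k + 1 + 1 by lia,
    show ((k : ℤ) + 1 - 1 + 1).toNat = k + 1 by lia]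
  refine ⟨⟨by lia, hdim.1.2.prod_unitInterval.susp⟩, fun h => hdim.2 ⟨by lia, ?_⟩⟩
  exact h.2.prod_unitInterval_of_susp.of_prod_unitInterval
end

section
/- Let C₁ and C₂ be Cantor sets and let Y = C₁ * C₂ be their topological join. Then every self-homeomorphism h of the suspension ΣY maps the two-point set {n, p} of suspension points onto itself. -/
open Set Filter Topology

universe u

/-- The equivalence generating the topological join: identify `(a,b,0) ~ (a,b',0)` and
`(a,b,1) ~ (a',b,1)`. -/
def joinRel (C₁ C₂ : Type u) : C₁ × C₂ × unitInterval → C₁ × C₂ × unitInterval → Prop :=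
  fun x y =>
    x = y ∨ (x.2.2 = 0 ∧ y.2.2 = 0 ∧ x.1 = y.1) ∨ (x.2.2 = 1 ∧ y.2.2 = 1 ∧ x.2.1 = y.2.1)

/-- The topological join `C₁ * C₂`, as a quotient of `C₁ × C₂ × [0,1]`. -/
def TopJoin (C₁ C₂ : Type u) : Type u := Quot (joinRel C₁ C₂)

instance (C₁ C₂ : Type u) [TopologicalSpace C₁] [TopologicalSpace C₂] :
    TopologicalSpace (TopJoin C₁ C₂) :=
  inferInstanceAs (TopologicalSpace (Quot (joinRel C₁ C₂)))

/-- The image of `(a, b, t)` in the join. -/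
def joinMk (C₁ C₂ : Type u) [TopologicalSpace C₁] [TopologicalSpace C₂]
    (a : C₁) (b : C₂) (t : unitInterval) : TopJoin C₁ C₂ := Quot.mk _ (a, b, t)

/-- The copy of `C₁` inside `C₁ * C₂`: the image of `C₁ × C₂ × {0}`. -/
def joinC1 (C₁ C₂ : Type u) [TopologicalSpace C₁] [TopologicalSpace C₂] :
    Set (TopJoin C₁ C₂) := {y | ∃ a b, y = joinMk C₁ C₂ a b 0}

/-- The copy of `C₂` inside `C₁ * C₂`: the image of `C₁ × C₂ × {1}`. -/
def joinC2 (C₁ C₂ : Type u) [TopologicalSpace C₁] [TopologicalSpace C₂] :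
    Set (TopJoin C₁ C₂) := {y | ∃ a b, y = joinMk C₁ C₂ a b 1}

/-- The join arc from `a ∈ C₁` to `b ∈ C₂`: the image of `{(a,b)} × [0,1]`. -/
def joinArc (C₁ C₂ : Type u) [TopologicalSpace C₁] [TopologicalSpace C₂]
    (a : C₁) (b : C₂) : Set (TopJoin C₁ C₂) := {y | ∃ t, y = joinMk C₁ C₂ a b t}

/-- The image of a saturated set under a quotient projection contains exactly the classes of
its elements. -/
lemma quot_mk_mem_image_iff {α : Type*} {r : α → α → Prop} {T : Set α}
    (hT : ∀ x y, r x y → (x ∈ T ↔ y ∈ T)) (x : α) : Quot.mk r x ∈ Quot.mk r '' T ↔ x ∈ T := by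
  refine ⟨?_, fun hx => ⟨x, hx, rfl⟩⟩
  rintro ⟨y, hy, hyx⟩
  have key : Quot.lift (fun z => z ∈ T) (fun a b hab => propext (hT a b hab)) (Quot.mk r x) := by
    rw [← hyx]
    exact hy
  exact key

/-- The image of a saturated open set under a quotient projection is open. -/
lemma isOpen_quot_mk_image {α : Type*} [TopologicalSpace α] {r : α → α → Prop} {T : Set α}
    (hT : ∀ x y, r x y → (x ∈ T ↔ y ∈ T)) (ho : IsOpen T) : IsOpen (Quot.mk r '' T) := by
  rw [← isQuotientMap_quot_mk.isOpen_preimage]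
  convert ho using 1
  ext x
  exact quot_mk_mem_image_iff hT x

/-- `X` is connected im kleinen at `x`: the point has a basis of preconnected neighbourhoods. -/
def ConnectedImKleinenAt {X : Type*} [TopologicalSpace X] (x : X) : Prop :=
  ∀ U ∈ 𝓝 x, ∃ V ∈ 𝓝 x, V ⊆ U ∧ IsPreconnected V

lemma ConnectedImKleinenAt.map_homeomorph {X Y : Type*} [TopologicalSpace X] [TopologicalSpace Y]
    (h : X ≃ₜ Y) {x : X} (hx : ConnectedImKleinenAt x) : ConnectedImKleinenAt (h x) := by
  intro U hU
  obtain ⟨V, hV, hVU, hVc⟩ := hx (h ⁻¹' U) (h.continuous.continuousAt hU)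
  refine ⟨h '' V, ?_, image_subset_iff.2 hVU, hVc.image _ h.continuous.continuousOn⟩
  rw [← h.map_nhds_eq]
  exact image_mem_map hV

lemma continuous_suspMk_s1 (W : Type u) [TopologicalSpace W] :
    Continuous fun x : W × unitInterval => suspMk W x.1 x.2 :=
  continuous_quot_mk

lemma continuous_joinMk (C₁ C₂ : Type u) [TopologicalSpace C₁] [TopologicalSpace C₂] :
    Continuous fun x : C₁ × C₂ × unitInterval => joinMk C₁ C₂ x.1 x.2.1 x.2.2 :=
  continuous_quot_mk

lemma suspMk_eq_of_pole (W : Type u) [TopologicalSpace W] {t : unitInterval}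
    (ht : t = 0 ∨ t = 1) (w w' : W) : suspMk W w t = suspMk W w' t := by
  apply Quot.sound
  rcases ht with rfl | rfl
  · exact Or.inr (Or.inl ⟨rfl, rfl⟩)
  · exact Or.inr (Or.inr ⟨rfl, rfl⟩)

/-- The suspension of a compact space is connected im kleinen at the suspension points. -/
lemma connectedImKleinenAt_of_mem_suspPoles {W : Type u} [TopologicalSpace W] [CompactSpace W]
    {z : Susp W} (hz : z ∈ suspPoles W) : ConnectedImKleinenAt z := by
  obtain ⟨w₀, t₀, rfl, ht₀⟩ := hz
  intro U hU
  have htube : ∀ᶠ t in 𝓝 t₀, ∀ w : W, suspMk W w t ∈ U := by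
    have := isCompact_univ.eventually_forall_of_forall_eventually (x₀ := t₀)
      (P := fun t w => suspMk W w t ∈ U) (fun w _ => by
        have hc := ((continuous_suspMk_s1 W).comp continuous_swap).continuousAt (x := (t₀, w))
        exact hc (by simpa [suspMk_eq_of_pole W ht₀ w w₀] using hU))
    simpa using this
  have hsymm : unitInterval.symm t₀ ≠ t₀ := by
    rcases ht₀ with rfl | rfl <;> simp
  have : LocallyConnectedSpace unitInterval :=
    (isQuotientMap_projIcc (h := zero_le_one (α := ℝ))).isCoinducing.locallyConnectedSpace
  obtain ⟨J, hJ, hJo, ht₀J, hJc⟩ := locallyConnectedSpace_iff_subsets_isOpen_isConnected.1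
    this t₀ _
    (htube.and (isOpen_ne.mem_nhds hsymm.symm : ∀ᶠ t in 𝓝 t₀, t ≠ unitInterval.symm t₀))
  have hsat : ∀ x y, suspRel W x y → (x ∈ (univ ×ˢ J : Set (W × unitInterval)) ↔
      y ∈ (univ ×ˢ J : Set (W × unitInterval))) := by
    rintro ⟨w, t⟩ ⟨w', t'⟩ (hxy | ⟨hx, hy⟩ | ⟨hx, hy⟩)
    · rw [hxy]
    all_goals
      simp only at hx hy
      simp [hx, hy]
  refine ⟨Quot.mk (suspRel W) '' (univ ×ˢ J), ?_, ?_, ?_⟩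
  · exact (isOpen_quot_mk_image hsat (isOpen_univ.prod hJo)).mem_nhds
      ⟨(w₀, t₀), ⟨trivial, ht₀J⟩, rfl⟩
  · rintro _ ⟨⟨w, t⟩, ⟨-, ht⟩, rfl⟩
    exact (hJ ht).1 w
  · refine isPreconnected_of_forall (suspMk W w₀ t₀) ?_
    rintro _ ⟨⟨w, t⟩, ⟨-, ht⟩, rfl⟩
    refine ⟨(fun s => suspMk W w s) '' J, ?_, ?_, ⟨t, ht, rfl⟩, ?_⟩
    · rintro _ ⟨s, hs, rfl⟩
      exact ⟨(w, s), ⟨trivial, hs⟩, rfl⟩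
    · exact ⟨t₀, ht₀J, suspMk_eq_of_pole W ht₀ w w₀⟩
    · exact hJc.isPreconnected.image _
        ((continuous_suspMk_s1 W).comp (Continuous.prodMk_right w)).continuousOn

/-- A product of a set with the open interval is saturated for the suspension relation. -/
lemma suspRel_saturated_prod_Ioo {W : Type u} (O : Set W) (x y : W × unitInterval)
    (hxy : suspRel W x y) :
    x ∈ O ×ˢ Ioo (0 : unitInterval) 1 ↔ y ∈ O ×ˢ Ioo (0 : unitInterval) 1 := by
  rcases hxy with hxy | ⟨hx, hy⟩ | ⟨hx, hy⟩
  · rw [hxy]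
  · simp [mem_prod, hx, hy]
  · simp [mem_prod, hx, hy]

/-- If some neighbourhood of `w` can be split into two open pieces, one containing `w` and the
other one meeting any prescribed neighbourhood of `w`, then the suspension is not connected
im kleinen at the interior points of the suspension arc through `w`. -/
lemma not_connectedImKleinenAt_suspMk {W : Type u} [TopologicalSpace W] {w : W}
    {t : unitInterval} (ht : t ∈ Ioo (0 : unitInterval) 1) {U : Set W} (hU : IsOpen U) (hw : w ∈ U)
    (hsplit : ∀ N ∈ 𝓝 w, ∃ O₁ O₂ : Set W, IsOpen O₁ ∧ IsOpen O₂ ∧ Disjoint O₁ O₂ ∧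
      U ⊆ O₁ ∪ O₂ ∧ w ∈ O₁ ∧ (N ∩ O₂).Nonempty) :
    ¬ ConnectedImKleinenAt (suspMk W w t) := by
  intro hc
  have hopen : ∀ O : Set W, IsOpen O →
      IsOpen (Quot.mk (suspRel W) '' (O ×ˢ Ioo (0 : unitInterval) 1)) := fun O hO =>
    isOpen_quot_mk_image (suspRel_saturated_prod_Ioo O) (hO.prod isOpen_Ioo)
  have hmem : ∀ w' : W, ∀ O : Set W, w' ∈ O →
      suspMk W w' t ∈ Quot.mk (suspRel W) '' (O ×ˢ Ioo (0 : unitInterval) 1) :=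
    fun w' O hw' => ⟨(w', t), ⟨hw', ht⟩, rfl⟩
  obtain ⟨V, hV, hVU, hVc⟩ := hc _ ((hopen U hU).mem_nhds (hmem w U hw))
  have hN : {w' | suspMk W w' t ∈ V} ∈ 𝓝 w :=
    ((continuous_suspMk_s1 W).comp (Continuous.prodMk_left t)).continuousAt hV
  obtain ⟨O₁, O₂, hO₁, hO₂, hd, hcov, hw₁, w', hw'V, hw'₂⟩ := hsplit _ hN
  obtain ⟨z, -, hz₁, hz₂⟩ := hVc _ _ (hopen O₁ hO₁) (hopen O₂ hO₂)
    (hVU.trans ((image_mono ((prod_mono_left hcov).trans union_prod.subset)).trans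
      (image_union _ _ _).subset))
    ⟨_, mem_of_mem_nhds hV, hmem w O₁ hw₁⟩ ⟨_, hw'V, hmem w' O₂ hw'₂⟩
  obtain ⟨x, hx, rfl⟩ := hz₁
  exact disjoint_left.1 hd hx.1
    ((quot_mk_mem_image_iff (suspRel_saturated_prod_Ioo O₂) x).1 hz₂).1

/-- In a Cantor set, no neighbourhood of a point is contained in all clopen sets around it. -/
lemma exists_isClopen_notMem_of_mem_nhds {C : Type*} [TopologicalSpace C]
    (e : C ≃ₜ (ℕ → Bool)) (a : C) {N : Set C} (hN : N ∈ 𝓝 a) :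
    ∃ A : Set C, IsClopen A ∧ a ∈ A ∧ ∃ a' ∈ N, a' ∉ A := by
  have hlim : Tendsto (fun n => Function.update (e a) n (!(e a n))) atTop (𝓝 (e a)) := by
    rw [tendsto_pi_nhds]
    intro k
    refine tendsto_const_nhds.congr' ?_
    filter_upwards [eventually_gt_atTop k] with n hn
    rw [Function.update_of_ne hn.ne]
  have hlim' := (e.symm.continuous.tendsto (e a)).comp hlim
  rw [e.symm_apply_apply] at hlim'
  obtain ⟨n, hn⟩ := (hlim'.eventually hN).exists
  refine ⟨{x | e x n = e a n}, ?_, rfl, _, hn, ?_⟩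
  · exact (isClopen_discrete {e a n}).preimage ((continuous_apply n).comp e.continuous)
  · simp

/-- The hypothesis of `not_connectedImKleinenAt_suspMk` holds at every point of the join of two
Cantor sets. -/
lemma exists_isOpen_split_joinMk {C₁ C₂ : Type u} [TopologicalSpace C₁] [TopologicalSpace C₂]
    (e₁ : C₁ ≃ₜ (ℕ → Bool)) (e₂ : C₂ ≃ₜ (ℕ → Bool)) (a : C₁) (b : C₂) (s : unitInterval) :
    ∃ U : Set (TopJoin C₁ C₂), IsOpen U ∧ joinMk C₁ C₂ a b s ∈ U ∧
      ∀ N ∈ 𝓝 (joinMk C₁ C₂ a b s), ∃ O₁ O₂ : Set (TopJoin C₁ C₂),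
        IsOpen O₁ ∧ IsOpen O₂ ∧ Disjoint O₁ O₂ ∧ U ⊆ O₁ ∪ O₂ ∧ joinMk C₁ C₂ a b s ∈ O₁ ∧
          (N ∩ O₂).Nonempty := by
  by_cases hs : s = 1
  · let T : Set C₂ → Set (C₁ × C₂ × unitInterval) := fun A => {x | x.2.1 ∈ A ∧ x.2.2 ≠ 0}
    have hT : ∀ A x y, joinRel C₁ C₂ x y → (x ∈ T A ↔ y ∈ T A) := by
      rintro A x y (h | ⟨hx, hy, -⟩ | ⟨hx, hy, h⟩)
      · rw [h]
      · simp [T, hx, hy]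
      · simp [T, hx, hy, h]
    have hTo : ∀ A, IsOpen A → IsOpen (Quot.mk (joinRel C₁ C₂) '' T A) := fun A hA =>
      isOpen_quot_mk_image (hT A) ((hA.preimage (continuous_fst.comp continuous_snd)).inter
        (isOpen_ne.preimage (continuous_snd.comp continuous_snd)))
    have hs0 : s ≠ 0 := by simp [hs]
    refine ⟨Quot.mk _ '' T univ, hTo _ isOpen_univ, ⟨(a, b, s), ⟨trivial, hs0⟩, rfl⟩, ?_⟩
    intro N hN
    have hc : Continuous fun y : C₂ => joinMk C₁ C₂ a y s :=
      (continuous_joinMk C₁ C₂).comp (by fun_prop : Continuous fun y : C₂ => (a, y, s))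
    obtain ⟨A, hA, hbA, b', hb'N, hb'A⟩ :=
      exists_isClopen_notMem_of_mem_nhds e₂ b (hc.continuousAt hN)
    refine ⟨_, _, hTo A hA.isOpen, hTo Aᶜ hA.compl.isOpen, ?_, ?_, ⟨_, ⟨hbA, hs0⟩, rfl⟩,
      joinMk C₁ C₂ a b' s, hb'N, ⟨(a, b', s), ⟨hb'A, hs0⟩, rfl⟩⟩
    · refine disjoint_left.2 ?_
      rintro _ ⟨x, hx, rfl⟩ hx'
      exact ((quot_mk_mem_image_iff (hT _) x).1 hx').1 hx.1
    · refine (image_mono fun x hx => ?_).trans (image_union _ _ _).subset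
      exact (em (x.2.1 ∈ A)).imp (⟨·, hx.2⟩) (⟨·, hx.2⟩)
  · let T : Set C₁ → Set (C₁ × C₂ × unitInterval) := fun A => {x | x.1 ∈ A ∧ x.2.2 ≠ 1}
    have hT : ∀ A x y, joinRel C₁ C₂ x y → (x ∈ T A ↔ y ∈ T A) := by
      rintro A x y (h | ⟨hx, hy, h⟩ | ⟨hx, hy, -⟩)
      · rw [h]
      · simp [T, hx, hy, h]
      · simp [T, hx, hy]
    have hTo : ∀ A, IsOpen A → IsOpen (Quot.mk (joinRel C₁ C₂) '' T A) := fun A hA =>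
      isOpen_quot_mk_image (hT A) ((hA.preimage continuous_fst).inter
        (isOpen_ne.preimage (continuous_snd.comp continuous_snd)))
    refine ⟨Quot.mk _ '' T univ, hTo _ isOpen_univ, ⟨(a, b, s), ⟨trivial, hs⟩, rfl⟩, ?_⟩
    intro N hN
    have hc : Continuous fun x : C₁ => joinMk C₁ C₂ x b s :=
      (continuous_joinMk C₁ C₂).comp (by fun_prop : Continuous fun x : C₁ => (x, b, s))
    obtain ⟨A, hA, haA, a', ha'N, ha'A⟩ :=
      exists_isClopen_notMem_of_mem_nhds e₁ a (hc.continuousAt hN)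
    refine ⟨_, _, hTo A hA.isOpen, hTo Aᶜ hA.compl.isOpen, ?_, ?_, ⟨_, ⟨haA, hs⟩, rfl⟩,
      joinMk C₁ C₂ a' b s, ha'N, ⟨(a', b, s), ⟨ha'A, hs⟩, rfl⟩⟩
    · refine disjoint_left.2 ?_
      rintro _ ⟨x, hx, rfl⟩ hx'
      exact ((quot_mk_mem_image_iff (hT _) x).1 hx').1 hx.1
    · refine (image_mono fun x hx => ?_).trans (image_union _ _ _).subset
      exact (em (x.1 ∈ A)).imp (⟨·, hx.2⟩) (⟨·, hx.2⟩)

/-- The suspension points are exactly the points at which the suspension of the join of two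
Cantor sets is connected im kleinen. -/
lemma mem_suspPoles_topJoin_iff {C₁ C₂ : Type u} [TopologicalSpace C₁] [TopologicalSpace C₂]
    (e₁ : C₁ ≃ₜ (ℕ → Bool)) (e₂ : C₂ ≃ₜ (ℕ → Bool)) (z : Susp (TopJoin C₁ C₂)) :
    z ∈ suspPoles (TopJoin C₁ C₂) ↔ ConnectedImKleinenAt z := by
  have : CompactSpace C₁ := e₁.symm.compactSpace
  have : CompactSpace C₂ := e₂.symm.compactSpace
  have : CompactSpace (TopJoin C₁ C₂) :=
    inferInstanceAs (CompactSpace (Quot (joinRel C₁ C₂)))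
  refine ⟨connectedImKleinenAt_of_mem_suspPoles, fun hz => ?_⟩
  obtain ⟨⟨w, t⟩, rfl⟩ := Quot.exists_rep z
  obtain ⟨⟨a, b, s⟩, rfl⟩ := Quot.exists_rep w
  by_contra hpole
  have ht : ¬ (t = 0 ∨ t = 1) := fun ht => hpole ⟨_, t, rfl, ht⟩
  rw [not_or] at ht
  obtain ⟨U, hU, hw, hsplit⟩ := exists_isOpen_split_joinMk e₁ e₂ a b s
  exact not_connectedImKleinenAt_suspMk
    ⟨unitInterval.pos_iff_ne_zero.2 ht.1, unitInterval.lt_one_iff_ne_one.2 ht.2⟩ hU hw hsplit hz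

/-- Every self-homeomorphism of the suspension of the join of two Cantor sets maps the
two-point set `{n, p}` of suspension points onto itself. -/
theorem homeomorph_preserves_suspension_points (C₁ C₂ : Type u)
    [TopologicalSpace C₁] [TopologicalSpace C₂]
    (e₁ : C₁ ≃ₜ (ℕ → Bool)) (e₂ : C₂ ≃ₜ (ℕ → Bool))
    (h : Susp (TopJoin C₁ C₂) ≃ₜ Susp (TopJoin C₁ C₂)) :
    h '' suspPoles (TopJoin C₁ C₂) = suspPoles (TopJoin C₁ C₂) := by
  ext z
  rw [mem_suspPoles_topJoin_iff e₁ e₂]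
  constructor
  · rintro ⟨x, hx, rfl⟩
    exact ((mem_suspPoles_topJoin_iff e₁ e₂ x).1 hx).map_homeomorph h
  · intro hz
    exact ⟨h.symm z, (mem_suspPoles_topJoin_iff e₁ e₂ _).2 (hz.map_homeomorph h.symm),
      h.apply_symm_apply z⟩
end

section
/- Let C₁ and C₂ be Cantor sets and let Y = C₁ * C₂ be their topological join, with suspension ΣY having suspension points n and p. Let 𝒞 denote the union over all c ∈ C₁ ∪ C₂ (viewed as subsets of Y) of the suspension arcs of ΣY through c, minus the points n and p. Then for every point q of ΣY lying outside 𝒞 ∪ {n, p}, every neighborhood of q contains an open neighborhood U of q such that the connected component of q in U is homeomorphic to an open subset of the Euclidean plane ℝ². -/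
open Set Filter Topology

universe u

/-- The set `𝒞`: the union of the suspension arcs of `Σ(C₁ * C₂)` through the points of
`C₁ ∪ C₂ ⊆ C₁ * C₂`, minus the two suspension points. -/
def cSet (C₁ C₂ : Type u) [TopologicalSpace C₁] [TopologicalSpace C₂] :
    Set (Susp (TopJoin C₁ C₂)) :=
  (⋃ c ∈ joinC1 C₁ C₂ ∪ joinC2 C₁ C₂, suspArc (TopJoin C₁ C₂) c) \ suspPoles (TopJoin C₁ C₂)

/-- A quotient map is an open embedding on an open set whose points are related only to
themselves. -/
theorem isOpenEmbedding_quotMk_of_trivial_on {X : Type*} [TopologicalSpace X]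
    {r : X → X → Prop} {O : Set X} (hO : IsOpen O)
    (hr : ∀ x y, r x y → x ∈ O ∨ y ∈ O → x = y) :
    IsOpenEmbedding (fun x : O => Quot.mk r x.1) := by
  have key : ∀ x y, Relation.EqvGen r x y → x ∈ O ∨ y ∈ O → x = y := by
    intro x y h
    induction h with
    | rel x y h => exact hr x y h
    | refl x => exact fun _ => rfl
    | symm x y _ ih => exact fun h => (ih h.symm).symm
    | trans x y z _ _ ih₁ ih₂ =>
      rintro (h | h)
      · obtain rfl := ih₁ (Or.inl h)
        exact ih₂ (Or.inl h)
      · obtain rfl := ih₂ (Or.inr h)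
        exact ih₁ (Or.inr h)
  refine IsOpenEmbedding.of_continuous_injective_isOpenMap
    (continuous_quot_mk.comp continuous_subtype_val) ?_ ?_
  · intro x y h
    exact Subtype.ext (key _ _ (Quot.eqvGen_exact h) (Or.inl x.2))
  · intro W hW
    rw [← isQuotientMap_quot_mk.isOpen_preimage]
    convert hO.isOpenMap_subtype_val W hW using 1
    ext x
    constructor
    · rintro ⟨y, hy, h⟩
      exact ⟨y, hy, key _ _ (Quot.eqvGen_exact h) (Or.inl y.2)⟩
    · rintro ⟨y, hy, rfl⟩
      exact ⟨y, hy, rfl⟩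

/-- The part of the join away from its two ends is the open subspace `C₁ × C₂ × (0,1)`. -/
theorem isOpenEmbedding_joinMk (C₁ C₂ : Type u) [TopologicalSpace C₁] [TopologicalSpace C₂] :
    IsOpenEmbedding (fun x : (C₁ × C₂) × Ioo (0 : unitInterval) 1 =>
      joinMk C₁ C₂ x.1.1 x.1.2 x.2) := by
  have hO : IsOpen {x : C₁ × C₂ × unitInterval | x.2.2 ∈ Ioo 0 1} :=
    isOpen_Ioo.preimage (by fun_prop)
  have h := isOpenEmbedding_quotMk_of_trivial_on (r := joinRel C₁ C₂) hO (by
    rintro x y (h | ⟨h₁, h₂, -⟩ | ⟨h₁, h₂, -⟩) h'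
    · exact h
    all_goals simp [h₁, h₂] at h')
  let e : (C₁ × C₂) × Ioo (0 : unitInterval) 1 ≃ₜ
      {x : C₁ × C₂ × unitInterval | x.2.2 ∈ Ioo 0 1} :=
    { toFun x := ⟨(x.1.1, x.1.2, x.2.1), x.2.2⟩
      invFun x := ((x.1.1, x.1.2.1), ⟨x.1.2.2, x.2⟩)
      continuous_toFun := by fun_prop
      continuous_invFun := by fun_prop }
  exact h.comp e.isOpenEmbedding

/-- The suspension away from its poles is the open subspace `W × (0,1)`. -/
theorem isOpenEmbedding_suspMk (W : Type u) [TopologicalSpace W] :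
    IsOpenEmbedding (fun x : W × Ioo (0 : unitInterval) 1 => suspMk W x.1 x.2) := by
  have hO : IsOpen {x : W × unitInterval | x.2 ∈ Ioo 0 1} :=
    isOpen_Ioo.preimage continuous_snd
  have h := isOpenEmbedding_quotMk_of_trivial_on (r := suspRel W) hO (by
    rintro x y (h | ⟨h₁, h₂⟩ | ⟨h₁, h₂⟩) h'
    · exact h
    all_goals simp [h₁, h₂] at h')
  let e : W × Ioo (0 : unitInterval) 1 ≃ₜ {x : W × unitInterval | x.2 ∈ Ioo 0 1} :=
    { toFun x := ⟨(x.1, x.2.1), x.2.2⟩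
      invFun x := (x.1.1, ⟨x.1.2, x.2⟩)
      continuous_toFun := by fun_prop
      continuous_invFun := by fun_prop }
  exact h.comp e.isOpenEmbedding

theorem isOpenEmbedding_coe_Ioo_unitInterval :
    IsOpenEmbedding (fun x : Ioo (0 : unitInterval) 1 => (x.1 : ℝ)) := by
  refine ⟨IsEmbedding.subtypeVal.comp IsEmbedding.subtypeVal, ?_⟩
  convert (isOpen_Ioo : IsOpen (Ioo (0 : ℝ) 1)) using 1
  ext x
  constructor
  · rintro ⟨y, rfl⟩
    exact y.2
  · intro hx
    exact ⟨⟨⟨x, hx.1.le, hx.2.le⟩, hx⟩, rfl⟩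

/-- In an open product of a totally disconnected and a locally connected space, small
components are slices over connected open sets of the second factor. -/
theorem exists_isOpen_connectedComponentIn_homeomorph {X T Z : Type*} [TopologicalSpace X]
    [TopologicalSpace T] [TopologicalSpace Z] [TotallyDisconnectedSpace X]
    [LocallyConnectedSpace T] {φ : X × T → Z} (hφ : IsOpenEmbedding φ) (x : X) (t : T)
    {N : Set Z} (hN : N ∈ 𝓝 (φ (x, t))) :
    ∃ U : Set Z, IsOpen U ∧ φ (x, t) ∈ U ∧ U ⊆ N ∧
      ∃ V : Set T, IsOpen V ∧ Nonempty (connectedComponentIn U (φ (x, t)) ≃ₜ V) := by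
  have hN' := hφ.continuous.continuousAt.preimage_mem_nhds hN
  obtain ⟨A, hA, B, hB, hAB⟩ := mem_nhds_prod_iff.1 hN'
  obtain ⟨A', hA', hA'o, hxA⟩ := mem_nhds_iff.1 hA
  obtain ⟨V, hVB, hVo, htV, hVc⟩ := locallyConnectedSpace_iff_subsets_isOpen_isConnected.1
    ‹_› t B hB
  have hU : φ (x, t) ∈ φ '' (A' ×ˢ V) := mem_image_of_mem _ ⟨hxA, htV⟩
  refine ⟨φ '' (A' ×ˢ V), hφ.isOpenMap _ (hA'o.prod hVo), hU,
    image_subset_iff.2 ((prod_mono hA' hVB).trans hAB), V, hVo, ?_⟩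
  have hslice : IsEmbedding (fun s : T => φ (x, s)) :=
    hφ.isEmbedding.comp (isEmbedding_prodMkRight x)
  have hcomp : connectedComponentIn (φ '' (A' ×ˢ V)) (φ (x, t)) = (fun s => φ (x, s)) '' V := by
    apply Subset.antisymm
    · have hsub := connectedComponentIn_subset (φ '' (A' ×ˢ V)) (φ (x, t))
      have hpre : IsPreconnected (φ ⁻¹' connectedComponentIn (φ '' (A' ×ˢ V)) (φ (x, t))) :=
        isPreconnected_connectedComponentIn.preimage_of_isOpenMap hφ.injective hφ.isOpenMap
          (hsub.trans (image_subset_range _ _))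
      have hss := (hpre.image Prod.fst continuous_fst.continuousOn).subsingleton
      intro z hz
      obtain ⟨⟨x', s⟩, ⟨-, hs⟩, rfl⟩ := hsub hz
      obtain rfl : x' = x := hss ⟨(x', s), hz, rfl⟩ ⟨(x, t), mem_connectedComponentIn hU, rfl⟩
      exact ⟨s, hs, rfl⟩
    · refine (hVc.isPreconnected.image _ hslice.continuous.continuousOn).subset_connectedComponentIn
        ⟨t, htV, rfl⟩ ?_
      rintro _ ⟨s, hs, rfl⟩
      exact ⟨(x, s), ⟨hxA, hs⟩, rfl⟩
  exact ⟨(Homeomorph.setCongr hcomp).trans (hslice.homeomorphImage V).symm⟩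

/-- A point of `Σ(C₁ * C₂)` off `𝒞` and the poles has both interval coordinates in `(0,1)`. -/
theorem exists_eq_suspMk_joinMk {C₁ C₂ : Type u} [TopologicalSpace C₁] [TopologicalSpace C₂]
    {q : Susp (TopJoin C₁ C₂)} (hq : q ∉ cSet C₁ C₂ ∪ suspPoles (TopJoin C₁ C₂)) :
    ∃ (a : C₁) (b : C₂) (s t : Ioo (0 : unitInterval) 1),
      q = suspMk (TopJoin C₁ C₂) (joinMk C₁ C₂ a b s) t := by
  have hmem : ∀ s : unitInterval, s ≠ 0 → s ≠ 1 → s ∈ Ioo (0 : unitInterval) 1 :=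
    fun s h₀ h₁ => ⟨unitInterval.pos_iff_ne_zero.2 h₀, unitInterval.lt_one_iff_ne_one.2 h₁⟩
  obtain ⟨⟨y, t⟩, rfl⟩ := Quot.exists_rep q
  obtain ⟨⟨a, b, s⟩, rfl⟩ := Quot.exists_rep y
  change suspMk (TopJoin C₁ C₂) (joinMk C₁ C₂ a b s) t ∉ _ at hq
  rw [mem_union, not_or] at hq
  obtain ⟨hc, hp⟩ := hq
  have hc' : ∀ c ∈ joinC1 C₁ C₂ ∪ joinC2 C₁ C₂, joinMk C₁ C₂ a b s ≠ c := by
    rintro _ h rfl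
    exact hc ⟨mem_biUnion h ⟨t, rfl⟩, hp⟩
  have hs := hmem s
    (by rintro rfl; exact hc' _ (Or.inl ⟨a, b, rfl⟩) rfl)
    (by rintro rfl; exact hc' _ (Or.inr ⟨a, b, rfl⟩) rfl)
  have ht := hmem t (fun h => hp ⟨_, t, rfl, Or.inl h⟩) (fun h => hp ⟨_, t, rfl, Or.inr h⟩)
  exact ⟨a, b, ⟨s, hs⟩, ⟨t, ht⟩, rfl⟩

/-- At every point of `Σ(C₁ * C₂)` away from `𝒞 ∪ {n, p}`, every neighborhood contains an
open neighborhood in which the connected component of the point is homeomorphic to an open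
subset of the Euclidean plane `ℝ²`. -/
theorem component_planar_off_cSet (C₁ C₂ : Type u)
    [TopologicalSpace C₁] [TopologicalSpace C₂]
    (e₁ : C₁ ≃ₜ (ℕ → Bool)) (e₂ : C₂ ≃ₜ (ℕ → Bool))
    (q : Susp (TopJoin C₁ C₂))
    (hq : q ∉ cSet C₁ C₂ ∪ suspPoles (TopJoin C₁ C₂)) :
    ∀ N ∈ 𝓝 q, ∃ U : Set (Susp (TopJoin C₁ C₂)), IsOpen U ∧ q ∈ U ∧ U ⊆ N ∧
      ∃ E : Set (ℝ × ℝ), IsOpen E ∧ Nonempty (↥(connectedComponentIn U q) ≃ₜ ↥E) := by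
  intro N hN
  have : TotallyDisconnectedSpace C₁ := e₁.symm.totallyDisconnectedSpace
  have : TotallyDisconnectedSpace C₂ := e₂.symm.totallyDisconnectedSpace
  have : LocallyConnectedSpace (Ioo (0 : unitInterval) 1) :=
    isOpenEmbedding_coe_Ioo_unitInterval.locallyConnectedSpace
  have : LocallyConnectedSpace (Ioo (0 : unitInterval) 1 × Ioo (0 : unitInterval) 1) :=
    (isOpenEmbedding_coe_Ioo_unitInterval.prodMap
      isOpenEmbedding_coe_Ioo_unitInterval).locallyConnectedSpace
  obtain ⟨a, b, s, t, rfl⟩ := exists_eq_suspMk_joinMk hq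
  have hφ := ((isOpenEmbedding_suspMk (TopJoin C₁ C₂)).comp
    ((isOpenEmbedding_joinMk C₁ C₂).prodMap IsOpenEmbedding.id)).comp
    (Homeomorph.prodAssoc (C₁ × C₂) (Ioo (0 : unitInterval) 1)
      (Ioo (0 : unitInterval) 1)).symm.isOpenEmbedding
  obtain ⟨U, hU, hqU, hUN, V, hV, ⟨h⟩⟩ :=
    exists_isOpen_connectedComponentIn_homeomorph hφ (a, b) (s, t) hN
  have hκ := isOpenEmbedding_coe_Ioo_unitInterval.prodMap isOpenEmbedding_coe_Ioo_unitInterval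
  exact ⟨U, hU, hqU, hUN, _, hκ.isOpenMap V hV, ⟨h.trans (hκ.isEmbedding.homeomorphImage V)⟩⟩
end

section
/- Let C₁ and C₂ be Cantor sets and let Y = C₁ * C₂ be their topological join, with suspension ΣY having suspension points n and p. Let 𝒞 denote the union over all c ∈ C₁ ∪ C₂ (viewed as subsets of Y) of the suspension arcs of ΣY through c, minus the points n and p. Then for every point q ∈ 𝒞 and every open neighborhood U of q in ΣY, the connected component of q in U is not homeomorphic to any open subset of the Euclidean plane ℝ². -/
open Set Filter Topology

universe u

/-- If a family of paths, indexed by a totally separated space `X` and all starting at `q`, is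
separated away from its endpoints by open sets `W D` indexed by the subsets `D` of `X`, and the
parameter `c₀` is not isolated, then no component of an open neighbourhood of `q` is locally
connected. -/
theorem not_locallyConnectedSpace_connectedComponentIn_of_fan {X Z : Type*} [TopologicalSpace X]
    [TotallySeparatedSpace X] [TopologicalSpace Z] (c₀ : X) [NeBot (𝓝[≠] c₀)]
    (g : X × unitInterval → Z) (hg : Continuous g) (q : Z) (hq : ∀ c, g (c, 0) = q)
    (W : Set X → Set Z) (hWopen : ∀ D, IsClopen D → IsOpen (W D))
    (hWunion : ∀ D, W univ ⊆ W D ∪ W Dᶜ) (hWdisj : ∀ D, Disjoint (W D) (W Dᶜ))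
    (hgW : ∀ D, ∀ c ∈ D, ∀ t : unitInterval, t ≠ 0 → t ≠ 1 → g (c, t) ∈ W D)
    (U : Set Z) (hU : IsOpen U) (hqU : q ∈ U) :
    ¬ LocallyConnectedSpace (connectedComponentIn U q) := by
  intro hlc
  have hnhds : g ⁻¹' U ∈ 𝓝 (c₀, (0 : unitInterval)) :=
    (hU.preimage hg).mem_nhds (by simpa [hq] using hqU)
  obtain ⟨N, hN, T, hT, hNT⟩ := mem_nhds_prod_iff.1 hnhds
  obtain ⟨u, hu, huT⟩ := exists_Ico_subset_of_mem_nhds hT ⟨1, zero_lt_one⟩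
  obtain ⟨t, ht0, htu⟩ := exists_between hu
  have ht1 : t ≠ 1 := (htu.trans_le unitInterval.le_one').ne
  have hmem : ∀ c ∈ N, g (c, t) ∈ connectedComponentIn U q := by
    intro c hc
    have hpre : IsPreconnected ((fun r : unitInterval => g (c, r)) '' Icc 0 t) :=
      isPreconnected_Icc.image _ (by fun_prop)
    refine hpre.subset_connectedComponentIn (x := q) ⟨0, ⟨le_rfl, ht0.le⟩, hq c⟩ ?_
      ⟨t, ⟨ht0.le, le_rfl⟩, rfl⟩
    rintro _ ⟨r, hr, rfl⟩
    exact hNT ⟨hc, huT ⟨hr.1, hr.2.trans_lt htu⟩⟩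
  let x : connectedComponentIn U q := ⟨g (c₀, t), hmem c₀ (mem_of_mem_nhds hN)⟩
  let O : Set (connectedComponentIn U q) := Subtype.val ⁻¹' W univ
  have hO : IsOpen O := (hWopen univ isClopen_univ).preimage continuous_subtype_val
  have hxO : x ∈ O := hgW univ c₀ trivial t ht0.ne' ht1
  obtain ⟨V, hV, hVO⟩ := isOpen_induced_iff.1 (hO.connectedComponentIn (x := x))
  have hxV : g (c₀, t) ∈ V := by
    have h : x ∈ connectedComponentIn O x := mem_connectedComponentIn hxO
    rwa [← hVO] at h
  have hNV : N ∩ (fun c => g (c, t)) ⁻¹' V ∈ 𝓝 c₀ :=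
    inter_mem hN ((hV.preimage (by fun_prop)).mem_nhds hxV)
  obtain ⟨c, ⟨hcN, hcV⟩, hc⟩ :=
    (nonempty_of_mem (inter_mem (mem_nhdsWithin_of_mem_nhds hNV) self_mem_nhdsWithin) :
      ((N ∩ (fun c => g (c, t)) ⁻¹' V) ∩ {c₀}ᶜ).Nonempty)
  obtain ⟨D, hD, hcD, hcD'⟩ := exists_isClopen_of_totally_separated (Ne.symm hc)
  let y : connectedComponentIn U q := ⟨g (c, t), hmem c hcN⟩
  have hy : y ∈ connectedComponentIn O x := hVO ▸ hcV
  have hconn : IsPreconnected (Subtype.val '' connectedComponentIn O x : Set Z) :=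
    isPreconnected_connectedComponentIn.image _ continuous_subtype_val.continuousOn
  obtain ⟨z, -, hz, hz'⟩ := hconn (W D) (W Dᶜ) (hWopen D hD) (hWopen Dᶜ hD.compl)
    (by
      rintro _ ⟨w, hw, rfl⟩
      exact hWunion D (connectedComponentIn_subset O x hw))
    ⟨_, ⟨x, mem_connectedComponentIn hxO, rfl⟩, hgW D c₀ hcD t ht0.ne' ht1⟩
    ⟨_, ⟨y, hy, rfl⟩, hgW Dᶜ c hcD' t ht0.ne' ht1⟩
  exact (hWdisj D).le_bot ⟨hz, hz'⟩

/-- The points of the join with join parameter in `(0, 1)` and coordinates in `D`. -/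
def joinInterior (C₁ C₂ : Type u) (D : Set (C₁ × C₂)) : Set (TopJoin C₁ C₂) :=
  {y | Quot.lift (fun x : C₁ × C₂ × unitInterval => (x.1, x.2.1) ∈ D ∧ x.2.2 ≠ 0 ∧ x.2.2 ≠ 1)
    (by
      rintro x y (rfl | ⟨hx, hy, -⟩ | ⟨hx, hy, -⟩)
      · rfl
      · simp [hx, hy]
      · simp [hx, hy]) y}

/-- The points of the suspension with height in `(0, 1)` and base point in `A`. -/
def suspInterior (W : Type u) (A : Set W) : Set (Susp W) :=
  {z | Quot.lift (fun x : W × unitInterval => x.1 ∈ A ∧ x.2 ≠ 0 ∧ x.2 ≠ 1)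
    (by
      rintro x y (rfl | ⟨hx, hy⟩ | ⟨hx, hy⟩)
      · rfl
      · simp [hx, hy]
      · simp [hx, hy]) z}

theorem isOpen_joinInterior {C₁ C₂ : Type u} [TopologicalSpace C₁] [TopologicalSpace C₂]
    {D : Set (C₁ × C₂)} (hD : IsOpen D) : IsOpen (joinInterior C₁ C₂ D) := by
  refine isOpen_coinduced.2 ?_
  change IsOpen {x : C₁ × C₂ × unitInterval | (x.1, x.2.1) ∈ D ∧ x.2.2 ≠ 0 ∧ x.2.2 ≠ 1}
  exact (hD.preimage (by fun_prop)).inter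
    ((isOpen_ne.preimage (by fun_prop)).inter (isOpen_ne.preimage (by fun_prop)))

theorem isOpen_suspInterior {W : Type u} [TopologicalSpace W] {A : Set W} (hA : IsOpen A) :
    IsOpen (suspInterior W A) := by
  refine isOpen_coinduced.2 ?_
  change IsOpen {x : W × unitInterval | x.1 ∈ A ∧ x.2 ≠ 0 ∧ x.2 ≠ 1}
  exact (hA.preimage continuous_fst).inter
    ((isOpen_ne.preimage continuous_snd).inter (isOpen_ne.preimage continuous_snd))

theorem continuous_suspMk_joinMk {C₁ C₂ : Type u} [TopologicalSpace C₁] [TopologicalSpace C₂]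
    (s : unitInterval) :
    Continuous fun x : C₁ × C₂ × unitInterval =>
      suspMk (TopJoin C₁ C₂) (joinMk C₁ C₂ x.1 x.2.1 x.2.2) s :=
  (continuous_quot_mk (r := suspRel (TopJoin C₁ C₂))).comp
    ((continuous_quot_mk (r := joinRel C₁ C₂)).prodMk continuous_const)

theorem suspInterior_joinInterior_subset_union_compl {C₁ C₂ : Type u} (D : Set (C₁ × C₂)) :
    suspInterior _ (joinInterior C₁ C₂ univ) ⊆
      suspInterior _ (joinInterior C₁ C₂ D) ∪ suspInterior _ (joinInterior C₁ C₂ Dᶜ) := by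
  rintro ⟨⟨x⟩, s⟩ ⟨⟨-, hx⟩, hs⟩
  by_cases h : (x.1, x.2.1) ∈ D
  exacts [Or.inl ⟨⟨h, hx⟩, hs⟩, Or.inr ⟨⟨h, hx⟩, hs⟩]

theorem disjoint_suspInterior_joinInterior_compl {C₁ C₂ : Type u} (D : Set (C₁ × C₂)) :
    Disjoint (suspInterior _ (joinInterior C₁ C₂ D))
      (suspInterior _ (joinInterior C₁ C₂ Dᶜ)) := by
  rw [Set.disjoint_left]
  rintro ⟨⟨x⟩, s⟩ ⟨⟨hx, -⟩, -⟩ ⟨⟨hx', -⟩, -⟩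
  exact hx' hx

/-- A fan of join arcs, pushed to height `s` in the suspension, obstructs local connectedness of
the components of neighbourhoods of its apex. -/
theorem not_locallyConnectedSpace_connectedComponentIn_of_join_fan {C₁ C₂ : Type u} {X : Type*}
    [TopologicalSpace C₁] [TopologicalSpace C₂] [TopologicalSpace X] [TotallySeparatedSpace X]
    (c₀ : X) [NeBot (𝓝[≠] c₀)] (F : X × unitInterval → C₁ × C₂ × unitInterval)
    (hF : Continuous F) (π : C₁ × C₂ → X) (hπ : Continuous π)
    (hπF : ∀ c t, π ((F (c, t)).1, (F (c, t)).2.1) = c)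
    (hF0 : ∀ c t, t ≠ 0 → t ≠ 1 → (F (c, t)).2.2 ≠ 0 ∧ (F (c, t)).2.2 ≠ 1)
    (s : unitInterval) (hs0 : s ≠ 0) (hs1 : s ≠ 1) (q : Susp (TopJoin C₁ C₂))
    (hq : ∀ c, suspMk _ (joinMk C₁ C₂ (F (c, 0)).1 (F (c, 0)).2.1 (F (c, 0)).2.2) s = q)
    (U : Set (Susp (TopJoin C₁ C₂))) (hU : IsOpen U) (hqU : q ∈ U) :
    ¬ LocallyConnectedSpace (connectedComponentIn U q) :=
  not_locallyConnectedSpace_connectedComponentIn_of_fan c₀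
    (fun x => suspMk _ (joinMk C₁ C₂ (F x).1 (F x).2.1 (F x).2.2) s)
    ((continuous_suspMk_joinMk s).comp hF) q hq
    (fun D => suspInterior _ (joinInterior C₁ C₂ (π ⁻¹' D)))
    (fun _ hD => isOpen_suspInterior (isOpen_joinInterior (hD.isOpen.preimage hπ)))
    (fun _ => suspInterior_joinInterior_subset_union_compl _)
    (fun _ => disjoint_suspInterior_joinInterior_compl _)
    (fun D c hc t ht0 ht1 => ⟨⟨(by simpa [hπF] using hc : π _ ∈ D), hF0 c t ht0 ht1⟩, hs0, hs1⟩)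
    U hU hqU

theorem nhdsNE_natToBool_neBot (c : ℕ → Bool) : NeBot (𝓝[≠] c) := by
  have hlim : Tendsto (fun n => Function.update c n (!c n)) atTop (𝓝 c) := by
    refine tendsto_pi_nhds.2 fun i => tendsto_const_nhds.congr' ?_
    filter_upwards [eventually_gt_atTop i] with n hn
    rw [Function.update_of_ne hn.ne]
  refine (tendsto_nhdsWithin_iff.2 ⟨hlim, Eventually.of_forall fun n => ?_⟩).neBot
  exact fun h : Function.update c n (!c n) = c => by simpa using congrFun h n

/-- At every point `q ∈ 𝒞` of `Σ(C₁ * C₂)` and for every open neighborhood `U` of `q`, the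
connected component of `q` in `U` is not homeomorphic to any open subset of the Euclidean
plane `ℝ²`. -/
theorem component_not_planar_on_cSet (C₁ C₂ : Type u)
    [TopologicalSpace C₁] [TopologicalSpace C₂]
    (e₁ : C₁ ≃ₜ (ℕ → Bool)) (e₂ : C₂ ≃ₜ (ℕ → Bool))
    (q : Susp (TopJoin C₁ C₂)) (hq : q ∈ cSet C₁ C₂) :
    ∀ U : Set (Susp (TopJoin C₁ C₂)), IsOpen U → q ∈ U →
      ∀ E : Set (ℝ × ℝ), IsOpen E → ¬ Nonempty (↥(connectedComponentIn U q) ≃ₜ ↥E) := by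
  rintro U hU hqU E hE ⟨e⟩
  have : LocallyConnectedSpace E := hE.locallyConnectedSpace
  have hlc : LocallyConnectedSpace (connectedComponentIn U q) :=
    e.isOpenEmbedding.locallyConnectedSpace
  have : NeBot (𝓝[≠] (fun _ : ℕ => true)) := nhdsNE_natToBool_neBot _
  obtain ⟨hq, hpole⟩ := hq
  simp only [mem_iUnion] at hq
  obtain ⟨y, hy, s, rfl⟩ := hq
  have hs0 : s ≠ 0 := fun h => hpole ⟨y, s, rfl, Or.inl h⟩
  have hs1 : s ≠ 1 := fun h => hpole ⟨y, s, rfl, Or.inr h⟩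
  rcases hy with ⟨a, b, rfl⟩ | ⟨a, b, rfl⟩
  · refine not_locallyConnectedSpace_connectedComponentIn_of_join_fan (fun _ : ℕ => true)
      (fun x => (a, e₂.symm x.1, x.2)) (by fun_prop) (fun x => e₂ x.2) (by fun_prop)
      (by simp) (fun _ _ h0 h1 => ⟨h0, h1⟩) s hs0 hs1 _ (fun c => ?_) U hU hqU hlc
    exact congrArg (suspMk _ · s) (Quot.sound (Or.inr (Or.inl ⟨rfl, rfl, rfl⟩)))
  · refine not_locallyConnectedSpace_connectedComponentIn_of_join_fan (fun _ : ℕ => true)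
      (fun x => (e₁.symm x.1, b, unitInterval.symm x.2)) (by fun_prop) (fun x => e₁ x.1)
      (by fun_prop) (by simp) (fun _ _ h0 h1 => ⟨by simpa using h1, by simpa using h0⟩)
      s hs0 hs1 _ (fun c => ?_) U hU hqU hlc
    exact congrArg (suspMk _ · s)
      (Quot.sound (Or.inr (Or.inr ⟨unitInterval.symm_zero, rfl, rfl⟩)))
end
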